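/- arXiv:2406.06892 — 2 statements merged into one kernel-verified Lean document; each statement's English description precedes it below -/
import Mathlib

section
/- Let ℓ = a/b > 1 be a rational number with a, b coprime positive integers, and let k₀ ≥ 1 be an integer. Then lim_{x→∞} #{n ≤ x : |σ(n) − ℓ·n| < k₀} / (x / log x) = ∑ 1/m, where the (finite) sum ranges over the positive integers m satisfying σ(m) = ℓ·m, b | m, and m < k₀/ℓ. -/
/-- `sigma1 n` is the sum of the positive divisors of `n`. -/
noncomputable def sigma1 (n : ℕ) : ℕ := ArithmeticFunction.sigma 1 n

open MeasureTheory Filter Topology Set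

noncomputable def fejK (x : ℝ) : ℝ := ∫ ξ in (0:ℝ)..1, (1 - ξ) * Real.cos (x * ξ)

lemma fejK_eq {x : ℝ} (hx : x ≠ 0) : fejK x = (1 - Real.cos x) / x ^ 2 := by
  have h : ∀ ξ ∈ uIcc (0:ℝ) 1, HasDerivAt
      (fun ξ => (1 - ξ) * (Real.sin (x * ξ) / x) - Real.cos (x * ξ) / x ^ 2)
      ((1 - ξ) * Real.cos (x * ξ)) ξ := by
    intro ξ _
    have hl : HasDerivAt (fun ξ : ℝ => x * ξ) x ξ := by
      simpa using (hasDerivAt_id ξ).const_mul x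
    have h1 : HasDerivAt (fun ξ : ℝ => 1 - ξ) (-1) ξ := by
      simpa using (hasDerivAt_id ξ).const_sub 1
    have h2 := (hl.sin).div_const x
    have h3 := (hl.cos).div_const (x ^ 2)
    convert! (h1.mul h2).sub h3 using 1
    field_simp
    ring
  rw [fejK, intervalIntegral.integral_eq_sub_of_hasDerivAt h]
  · simp
    ring
  · apply Continuous.intervalIntegrable
    fun_prop

lemma fejK_continuous : Continuous fejK := by
  unfold fejK
  apply intervalIntegral.continuous_parametric_intervalIntegral_of_continuous'
  fun_prop

lemma fejK_zero : fejK 0 = 1 / 2 := by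
  simp only [fejK, zero_mul, Real.cos_zero, mul_one]
  rw [intervalIntegral.integral_sub (by simp) (by simp)]
  simp
  norm_num

lemma fejK_nonneg (x : ℝ) : 0 ≤ fejK x := by
  by_cases hx : x = 0
  · rw [hx, fejK_zero]; norm_num
  · rw [fejK_eq hx]
    have := Real.cos_le_one x
    apply div_nonneg <;> [linarith; positivity]

lemma fejK_le (x : ℝ) : fejK x ≤ 4 * (1 + x ^ 2)⁻¹ := by
  by_cases hx : x = 0
  · rw [hx, fejK_zero]; norm_num
  rw [fejK_eq hx, ← div_eq_mul_inv]
  have h2 : 0 < x ^ 2 := by positivity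
  have h3 := Real.one_sub_sq_div_two_le_cos (x := x)
  have h4 := Real.neg_one_le_cos x
  rw [div_le_div_iff₀ h2 (by positivity)]
  by_cases h : x ^ 2 ≤ 1
  · nlinarith
  · nlinarith

lemma fejK_integrable : Integrable fejK := by
  refine Integrable.mono' (integrable_inv_one_add_sq.const_mul 4)
    fejK_continuous.aestronglyMeasurable (Eventually.of_forall fun x => ?_)
  rw [Real.norm_of_nonneg (fejK_nonneg x)]
  exact fejK_le x

lemma fejK_integral_pos : 0 < ∫ x, fejK x := by
  rw [integral_pos_iff_support_of_nonneg fejK_nonneg fejK_integrable]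
  apply IsOpen.measure_pos
  · exact isOpen_ne_fun fejK_continuous continuous_const
  · exact ⟨0, by simp [fejK_zero]⟩

lemma fejK_complex (x : ℝ) :
    (∫ ξ in Ioc (0:ℝ) 1, (1 - ξ : ℂ) * Complex.exp (Complex.I * x * ξ)).re = fejK x := by
  have hint : IntegrableOn (fun ξ : ℝ => (1 - ξ : ℂ) * Complex.exp (Complex.I * x * ξ)) (Ioc 0 1) :=
    (Continuous.integrableOn_Icc (by fun_prop)).mono_set Ioc_subset_Icc_self
  have := Complex.reCLM.integral_comp_comm hint
  simp only [Complex.reCLM_apply] at this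
  rw [← this, fejK, intervalIntegral.integral_of_le zero_le_one]
  congr 1
  ext ξ
  have : Complex.I * x * ξ = ((x * ξ : ℝ) : ℂ) * Complex.I := by push_cast; ring
  rw [this]
  have h2 : (1 - ξ : ℂ) = ((1 - ξ : ℝ) : ℂ) := by push_cast; ring
  rw [h2, Complex.re_ofReal_mul, Complex.exp_ofReal_mul_I_re]

lemma tauber_stepA (f : ℝ → ℝ) (hf : Measurable f) (C : ℝ) (hC : ∀ t, |f t| ≤ C) (H : ℂ → ℂ)
    (hL : ∀ s : ℂ, 0 < s.re → ∫ t in Ioi (0:ℝ), (f t : ℂ) * Complex.exp (-s * t) = H s)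
    (L : ℝ) (y : ℝ) (ε : ℝ) (hε : 0 < ε) :
    ∫ t in Ioi (0:ℝ), Real.exp (-ε * t) * (f t * fejK (L * (y - t))) =
    (∫ ξ in Ioc (0:ℝ) 1, (1 - ξ : ℂ) * Complex.exp (Complex.I * (L * y) * ξ) *
      H (ε + Complex.I * L * ξ)).re := by
  have hC0 : 0 ≤ C := (abs_nonneg _).trans (hC 0)
  set F : ℝ → ℝ → ℂ := fun ξ t => (1 - ξ : ℂ) * Complex.exp (Complex.I * (L * y) * ξ) *
    ((f t : ℂ) * Complex.exp (-(ε + Complex.I * L * ξ) * t)) with hF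
  have hFint : Integrable (Function.uncurry F)
      ((volume.restrict (Ioc (0:ℝ) 1)).prod (volume.restrict (Ioi (0:ℝ)))) := by
    have hexp : Integrable (fun t : ℝ => Real.exp (-ε * t)) (volume.restrict (Ioi (0:ℝ))) :=
      exp_neg_integrableOn_Ioi 0 hε
    have hb : Integrable (fun z : ℝ × ℝ => C * Real.exp (-ε * z.2))
        ((volume.restrict (Ioc (0:ℝ) 1)).prod (volume.restrict (Ioi (0:ℝ)))) :=
      Integrable.mul_prod (integrable_const C) hexp
    refine Integrable.mono' hb ?_ ?_
    · apply Measurable.aestronglyMeasurable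
      simp only [hF]
      fun_prop
    · rw [Measure.prod_restrict]
      filter_upwards [ae_restrict_mem (measurableSet_Ioc.prod measurableSet_Ioi)] with z hz
      obtain ⟨⟨h1, h2⟩, h3⟩ := hz
      simp only [hF, Function.uncurry, norm_mul, Complex.norm_exp]
      have e1 : (Complex.I * (L * y) * z.1).re = 0 := by simp
      have e2 : (-(ε + Complex.I * L * z.1) * z.2).re = -ε * z.2 := by simp
      have e3 : ‖(1 - z.1 : ℂ)‖ ≤ 1 := by
        have : (1 - z.1 : ℂ) = ((1 - z.1 : ℝ) : ℂ) := by push_cast; ring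
        rw [this, Complex.norm_real, Real.norm_of_nonneg (by linarith)]
        linarith
      rw [e1, e2, Real.exp_zero, mul_one, Complex.norm_real, Real.norm_eq_abs]
      calc _ ≤ 1 * (C * Real.exp (-ε * z.2)) := by gcongr; exact hC _
        _ = _ := one_mul _
  have h1 : ∫ ξ in Ioc (0:ℝ) 1, (1 - ξ : ℂ) * Complex.exp (Complex.I * (L * y) * ξ) *
      H (ε + Complex.I * L * ξ) = ∫ ξ in Ioc (0:ℝ) 1, ∫ t in Ioi (0:ℝ), F ξ t := by
    congr 1
    ext ξ
    rw [← hL _ (by simpa using hε), ← integral_const_mul]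
  rw [h1, integral_integral_swap hFint]
  have h2 := Complex.reCLM.integral_comp_comm hFint.integral_prod_right
  simp only [Complex.reCLM_apply, Function.uncurry] at h2
  rw [← h2]
  congr 1
  ext t
  have h3 : ∫ ξ in Ioc (0:ℝ) 1, F ξ t = ((Real.exp (-ε * t) * f t : ℝ) : ℂ) *
      ∫ ξ in Ioc (0:ℝ) 1, (1 - ξ : ℂ) * Complex.exp (Complex.I * (L * (y - t) : ℝ) * ξ) := by
    rw [← integral_const_mul]
    congr 1
    ext ξ
    simp only [hF]
    have : Complex.exp (Complex.I * (L * y) * ξ) * Complex.exp (-(ε + Complex.I * L * ξ) * t)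
      = Complex.exp (-ε * t) * Complex.exp (Complex.I * (L * (y - t) : ℝ) * ξ) := by
      rw [← Complex.exp_add, ← Complex.exp_add]
      congr 1
      push_cast
      ring
    push_cast at this ⊢
    linear_combination ((1 - ξ : ℂ) * f t) * this
  rw [h3, Complex.re_ofReal_mul, fejK_complex, mul_assoc]

lemma tauber_stepB (f : ℝ → ℝ) (hf : Measurable f) (C : ℝ) (hC : ∀ t, |f t| ≤ C) (H : ℂ → ℂ)
    (hH : ContinuousOn H {s | 0 ≤ s.re})
    (hL : ∀ s : ℂ, 0 < s.re → ∫ t in Ioi (0:ℝ), (f t : ℂ) * Complex.exp (-s * t) = H s)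
    (L : ℝ) (hL0 : 0 < L) (y : ℝ) :
    ∫ t in Ioi (0:ℝ), f t * fejK (L * (y - t)) =
    (∫ ξ in Ioc (0:ℝ) 1, (1 - ξ : ℂ) * Complex.exp (Complex.I * (L * y) * ξ) *
      H (Complex.I * L * ξ)).re := by
  have hKint : Integrable (fun t => fejK (L * (y - t))) :=
    (fejK_integrable.comp_mul_left' hL0.ne').comp_sub_left y
  have hlim1 : Tendsto (fun ε : ℝ => ∫ t in Ioi (0:ℝ), Real.exp (-ε * t) *
      (f t * fejK (L * (y - t)))) (𝓝[>] 0) (𝓝 (∫ t in Ioi (0:ℝ), f t * fejK (L * (y - t)))) := by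
    refine tendsto_integral_filter_of_dominated_convergence
      (fun t => C * fejK (L * (y - t))) ?_ ?_ (hKint.const_mul C).integrableOn ?_
    · refine Eventually.of_forall fun ε => Measurable.aestronglyMeasurable ?_
      have := fejK_continuous.measurable
      fun_prop
    · filter_upwards [self_mem_nhdsWithin] with ε hε
      filter_upwards [ae_restrict_mem measurableSet_Ioi] with t ht
      rw [norm_mul, norm_mul, Real.norm_of_nonneg (Real.exp_nonneg _),
        Real.norm_of_nonneg (fejK_nonneg _)]
      have h1 : Real.exp (-ε * t) ≤ 1 := by
        rw [Real.exp_le_one_iff]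
        have := mul_pos (show (0:ℝ) < ε from hε) (show (0:ℝ) < t from ht)
        linarith
      have hK := fejK_nonneg (L * (y - t))
      calc _ ≤ 1 * (C * fejK (L * (y - t))) := by
            gcongr
            exact hC t
        _ = _ := one_mul _
    · refine Eventually.of_forall fun t => ?_
      have : Tendsto (fun ε : ℝ => Real.exp (-ε * t) * (f t * fejK (L * (y - t)))) (𝓝 0)
          (𝓝 (Real.exp (-0 * t) * (f t * fejK (L * (y - t))))) := by
        apply Continuous.tendsto
        fun_prop
      simp only [neg_zero, zero_mul, Real.exp_zero, one_mul] at this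
      exact this.mono_left nhdsWithin_le_nhds
  have hcomp : IsCompact ((fun z : ℝ × ℝ => (z.1 + Complex.I * L * z.2 : ℂ)) ''
      (Icc 0 1 ×ˢ Icc 0 1)) :=
    (isCompact_Icc.prod isCompact_Icc).image (by fun_prop)
  have hsub : ((fun z : ℝ × ℝ => (z.1 + Complex.I * L * z.2 : ℂ)) ''
      (Icc 0 1 ×ˢ Icc 0 1)) ⊆ {s | 0 ≤ s.re} := by
    rintro _ ⟨z, ⟨hz1, hz2⟩, rfl⟩
    simpa using hz1.1
  obtain ⟨B, hB⟩ := hcomp.exists_bound_of_continuousOn (hH.mono hsub)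
  have hcontε : ∀ ε : ℝ, 0 ≤ ε → ContinuousOn (fun ξ : ℝ => H (ε + Complex.I * L * ξ)) univ := by
    intro ε hε
    refine hH.comp (by fun_prop) ?_
    intro ξ _
    simpa using hε
  have hlim2 : Tendsto (fun ε : ℝ => ∫ ξ in Ioc (0:ℝ) 1, (1 - ξ : ℂ) *
      Complex.exp (Complex.I * (L * y) * ξ) * H (ε + Complex.I * L * ξ)) (𝓝[>] 0)
      (𝓝 (∫ ξ in Ioc (0:ℝ) 1, (1 - ξ : ℂ) * Complex.exp (Complex.I * (L * y) * ξ) *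
      H (Complex.I * L * ξ))) := by
    refine tendsto_integral_filter_of_dominated_convergence
      (fun t => B) ?_ ?_ (integrable_const B) ?_
    · filter_upwards [self_mem_nhdsWithin] with ε hε
      have := continuousOn_univ.mp (hcontε ε (le_of_lt hε))
      refine Continuous.aestronglyMeasurable (Continuous.mul (by fun_prop) this)
    · have : Iio (1:ℝ) ∈ 𝓝[>] (0:ℝ) := mem_nhdsWithin_of_mem_nhds (Iio_mem_nhds one_pos)
      filter_upwards [self_mem_nhdsWithin, this] with ε hε hε1
      filter_upwards [ae_restrict_mem measurableSet_Ioc] with ξ hξ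
      have hb := hB _ ⟨(ε, ξ), ⟨⟨le_of_lt hε, le_of_lt hε1⟩, ⟨hξ.1.le, hξ.2⟩⟩, rfl⟩
      simp only [norm_mul, Complex.norm_exp]
      have e1 : (Complex.I * (L * y) * ξ).re = 0 := by simp
      have e3 : ‖(1 - ξ : ℂ)‖ ≤ 1 := by
        have : (1 - ξ : ℂ) = ((1 - ξ : ℝ) : ℂ) := by push_cast; ring
        rw [this, Complex.norm_real, Real.norm_of_nonneg (by linarith [hξ.2])]
        linarith [hξ.1]
      rw [e1, Real.exp_zero, mul_one]
      calc _ ≤ 1 * B := by gcongr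
        _ = _ := one_mul _
    · refine Eventually.of_forall fun ξ => ?_
      refine Tendsto.const_mul _ ?_
      have hc : ContinuousWithinAt H {s | 0 ≤ s.re} (Complex.I * L * ξ) :=
        hH _ (by simp)
      refine hc.tendsto.comp ?_
      refine tendsto_nhdsWithin_iff.mpr ⟨?_, ?_⟩
      · have : Tendsto (fun ε : ℝ => (ε + Complex.I * L * ξ : ℂ)) (𝓝 0)
          (𝓝 (((0:ℝ):ℂ) + Complex.I * L * ξ)) := by
          apply Continuous.tendsto
          fun_prop
        simp only [Complex.ofReal_zero, zero_add] at this
        exact this.mono_left nhdsWithin_le_nhds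
      · filter_upwards [self_mem_nhdsWithin] with ε hε
        simpa using le_of_lt hε
  have hlim3 := (Complex.continuous_re.tendsto _).comp hlim2
  refine tendsto_nhds_unique (hlim1.congr' ?_) hlim3
  filter_upwards [self_mem_nhdsWithin] with ε hε
  exact tauber_stepA f hf C hC H hL L y ε hε

lemma tauber_stepC (f : ℝ → ℝ) (hf : Measurable f) (C : ℝ) (hC : ∀ t, |f t| ≤ C) (H : ℂ → ℂ)
    (hH : ContinuousOn H {s | 0 ≤ s.re})
    (hL : ∀ s : ℂ, 0 < s.re → ∫ t in Ioi (0:ℝ), (f t : ℂ) * Complex.exp (-s * t) = H s)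
    (L : ℝ) (hL0 : 0 < L) :
    Tendsto (fun y => ∫ t in Ioi (0:ℝ), f t * fejK (L * (y - t))) atTop (𝓝 0) := by
  have hRL := Real.tendsto_integral_exp_smul_cocompact
    (indicator (Ioc (0:ℝ) 1) (fun ξ : ℝ => (1 - ξ : ℂ) * H (Complex.I * L * ξ)))
  have ht : Tendsto (fun y : ℝ => - (L * y / (2 * Real.pi))) atTop (cocompact ℝ) := by
    have : Tendsto (fun y : ℝ => - (L * y / (2 * Real.pi))) atTop atBot := by
      refine tendsto_neg_atTop_atBot.comp ?_
      refine Tendsto.atTop_div_const (by positivity) ?_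
      exact Tendsto.const_mul_atTop hL0 tendsto_id
    exact this.mono_right atBot_le_cocompact
  have h2 := (Complex.continuous_re.tendsto _).comp (hRL.comp ht)
  simp only [Complex.zero_re] at h2
  refine h2.congr fun y => ?_
  rw [tauber_stepB f hf C hC H hH hL L hL0 y]
  simp only [Function.comp]
  congr 1
  rw [← integral_indicator measurableSet_Ioc]
  congr 1
  ext ξ
  by_cases hξ : ξ ∈ Ioc (0:ℝ) 1
  · simp only [indicator_of_mem hξ, Circle.smul_def, smul_eq_mul, Real.fourierChar_apply]
    have : (((2 * Real.pi * -(ξ * -(L * y / (2 * Real.pi))) : ℝ)) : ℂ) * Complex.I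
        = Complex.I * (L * y) * ξ := by
      have hpi : (Real.pi : ℂ) ≠ 0 := by exact_mod_cast Real.pi_ne_zero
      push_cast
      field_simp
    rw [this]
    ring
  · simp [indicator_of_notMem hξ]

/-! ### Tauberian conclusion -/

lemma tauber_limit (u : ℝ → ℝ) (hu : Measurable u) (C : ℝ) (hu0 : ∀ t, 0 ≤ u t)
    (hC : ∀ t, u t ≤ C) (hneg : ∀ t, t ≤ 0 → u t = 0)
    (H : ℂ → ℂ) (hH : ContinuousOn H {s | 0 ≤ s.re})
    (hL : ∀ s : ℂ, 0 < s.re →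
      ∫ t in Ioi (0:ℝ), ((u t - 1 : ℝ) : ℂ) * Complex.exp (-s * t) = H s)
    (L : ℝ) (hL0 : 0 < L) :
    Tendsto (fun y => ∫ s, u (y - s / L) * fejK s) atTop (𝓝 (∫ s, fejK s)) := by
  have hKL : Integrable (fun s => fejK (L * s)) := fejK_integrable.comp_mul_left' hL0.ne'
  have hKint : ∀ y, Integrable (fun t => fejK (L * (y - t))) := fun y => hKL.comp_sub_left y
  have hC0 : 0 ≤ C := (hu0 0).trans (hC 0)
  have h1 := tauber_stepC (fun t => u t - 1) (by fun_prop) (C + 1)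
    (fun t => by rw [abs_le]; constructor <;> linarith [hu0 t, hC t]) H hH hL L hL0
  have huint : ∀ y, Integrable (fun t => u t * fejK (L * (y - t))) := by
    intro y
    refine (hKint y).bdd_mul (c := C) hu.aestronglyMeasurable (Eventually.of_forall fun t => ?_)
    rw [Real.norm_of_nonneg (hu0 t)]
    exact hC t
  have h2 : Tendsto (fun y => ∫ t in Ioi (0:ℝ), fejK (L * (y - t))) atTop
      (𝓝 (∫ s, fejK (L * s))) := by
    have e : ∀ y, ∫ t in Ioi (0:ℝ), fejK (L * (y - t)) =
        ∫ s, indicator (Iio y) (fun s => fejK (L * s)) s := by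
      intro y
      rw [← integral_indicator measurableSet_Ioi, ← integral_sub_left_eq_self _ volume y]
      congr 1
      ext s
      by_cases hs : s < y
      · rw [indicator_of_mem (by simpa using hs), indicator_of_mem (by simpa using hs)]
        congr 1
        ring
      · rw [indicator_of_notMem (by simpa using hs), indicator_of_notMem (by simpa using hs)]
    simp_rw [e]
    refine tendsto_integral_filter_of_dominated_convergence (fun s => fejK (L * s)) ?_ ?_ hKL ?_
    · exact Eventually.of_forall fun y => hKL.aestronglyMeasurable.indicator measurableSet_Iio
    · refine Eventually.of_forall fun y => Eventually.of_forall fun s => ?_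
      refine (norm_indicator_le_norm_self _ _).trans ?_
      rw [Real.norm_of_nonneg (fejK_nonneg _)]
    · refine Eventually.of_forall fun s => ?_
      refine tendsto_const_nhds.congr' ?_
      filter_upwards [eventually_gt_atTop s] with y hy
      rw [indicator_of_mem (by simpa using hy)]
  have h3 := (h1.add h2).const_mul L
  have e2 : L * (0 + ∫ s, fejK (L * s)) = ∫ s, fejK s := by
    rw [zero_add, Measure.integral_comp_mul_left, abs_of_pos (by positivity), smul_eq_mul]
    field_simp
  rw [e2] at h3
  refine h3.congr fun y => ?_
  rw [← integral_add]
  · have e3 : ∫ t in Ioi (0:ℝ), ((u t - 1) * fejK (L * (y - t)) + fejK (L * (y - t))) =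
        ∫ t, u t * fejK (L * (y - t)) := by
      rw [← integral_indicator measurableSet_Ioi]
      congr 1
      ext t
      by_cases ht : 0 < t
      · rw [indicator_of_mem (by simpa using ht)]
        ring
      · rw [indicator_of_notMem (by simpa using ht), hneg t (not_lt.mp ht), zero_mul]
    rw [e3, ← integral_sub_left_eq_self _ volume y]
    have e4 := Measure.integral_comp_mul_left (fun s => u (y - s / L) * fejK s) L
    rw [abs_of_pos (by positivity), smul_eq_mul] at e4
    have e5 : ∫ s, u (y - s / L) * fejK s = L * (L⁻¹ * ∫ s, u (y - s / L) * fejK s) := by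
      field_simp
    rw [e5, ← e4]
    congr 2
    ext s
    rw [mul_div_cancel_left₀ _ hL0.ne', sub_sub_cancel]
  · have := ((huint y).sub (hKint y)).integrableOn (s := Ioi (0:ℝ))
    refine this.congr (Eventually.of_forall fun t => ?_)
    simp only [Pi.sub_apply]
    ring
  · exact (hKint y).integrableOn

lemma fejK_Icc_tendsto :
    Tendsto (fun M : ℝ => ∫ s in Icc (-M) M, fejK s) atTop (𝓝 (∫ s, fejK s)) := by
  have := (aecover_Icc (μ := (volume : Measure ℝ)) (a := fun M : ℝ => -M) (b := fun M : ℝ => M)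
    (l := atTop) tendsto_neg_atTop_atBot tendsto_id).integral_tendsto_of_countably_generated
    fejK_integrable
  exact this

lemma tauber_final (u : ℝ → ℝ) (hu : Measurable u) (C : ℝ) (hu0 : ∀ t, 0 ≤ u t)
    (hC : ∀ t, u t ≤ C) (hmono : ∀ s t, s ≤ t → u s * Real.exp (s - t) ≤ u t)
    (hlim : ∀ L : ℝ, 0 < L →
      Tendsto (fun y => ∫ s, u (y - s / L) * fejK s) atTop (𝓝 (∫ s, fejK s))) :
    Tendsto u atTop (𝓝 1) := by
  have hC0 : 0 ≤ C := (hu0 0).trans (hC 0)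
  set c := ∫ s, fejK s with hc
  have hcpos : 0 < c := fejK_integral_pos
  have hint : ∀ L y : ℝ, Integrable (fun s => u (y - s / L) * fejK s) := by
    intro L y
    refine fejK_integrable.bdd_mul (c := C) (by
      apply Measurable.aestronglyMeasurable
      fun_prop) (Eventually.of_forall fun t => ?_)
    rw [Real.norm_of_nonneg (hu0 _)]
    exact hC _
  have hexp : ∀ a b : ℝ, Tendsto (fun δ : ℝ => a * Real.exp (b * δ)) (𝓝[>] 0) (𝓝 a) := by
    intro a b
    have : Tendsto (fun δ : ℝ => a * Real.exp (b * δ)) (𝓝 0) (𝓝 (a * Real.exp (b * 0))) :=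
      Continuous.tendsto (by fun_prop) _
    rw [mul_zero, Real.exp_zero, mul_one] at this
    exact this.mono_left nhdsWithin_le_nhds
  refine tendsto_order.mpr ⟨fun q hq => ?_, fun q hq => ?_⟩
  · -- lower bound
    have hM1 : Tendsto (fun M : ℝ => q * c + C * (c - ∫ s in Icc (-M) M, fejK s)) atTop
        (𝓝 (q * c + C * (c - c))) :=
      ((fejK_Icc_tendsto.const_sub c).const_mul C).const_add (q * c)
    have hlt : q * c + C * (c - c) < c := by nlinarith
    obtain ⟨M, hM, hMpos⟩ := ((hM1.eventually_lt_const hlt).and (eventually_gt_atTop 0)).exists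
    set cM := ∫ s in Icc (-M) M, fejK s with hcM
    have hd := ((hexp (q * c) 2).add_const (C * (c - cM))).eventually_lt_const hM
    obtain ⟨δ, hδ, hδpos⟩ := (hd.and self_mem_nhdsWithin).exists
    replace hδpos : 0 < δ := hδpos
    have hLpos : 0 < M / δ := by positivity
    have hJ := (hlim (M / δ) hLpos).comp (tendsto_atTop_add_const_right atTop (-δ) tendsto_id)
    filter_upwards [hJ.eventually_const_lt hδ] with y hy
    simp only [Function.comp, id] at hy
    have hle : ∫ s, u (y + -δ - s / (M / δ)) * fejK s ≤
        u y * Real.exp (2 * δ) * c + C * (c - cM) := by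
      have hsplit := integral_add_compl (μ := volume) (measurableSet_Icc (a := -M) (b := M))
        (hint (M / δ) (y + -δ))
      have hsplit2 := integral_add_compl (μ := volume) (measurableSet_Icc (a := -M) (b := M))
        fejK_integrable
      rw [← hcM, ← hc] at hsplit2
      have b1 : ∫ s in Icc (-M) M, u (y + -δ - s / (M / δ)) * fejK s ≤
          ∫ s in Icc (-M) M, (u y * Real.exp (2 * δ)) * fejK s := by
        refine setIntegral_mono_on (hint _ _).integrableOn
          (fejK_integrable.const_mul _).integrableOn measurableSet_Icc fun s hs => ?_
        refine mul_le_mul_of_nonneg_right ?_ (fejK_nonneg s)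
        have hs1 : -δ ≤ s / (M / δ) := by
          rw [le_div_iff₀ hLpos]; field_simp; linarith [hs.1]
        have hs2 : s / (M / δ) ≤ δ := by
          rw [div_le_iff₀ hLpos]; field_simp; linarith [hs.2]
        have := hmono (y + -δ - s / (M / δ)) y (by linarith)
        have h5 : Real.exp (-(2 * δ)) ≤ Real.exp (y + -δ - s / (M / δ) - y) :=
          Real.exp_le_exp.mpr (by linarith)
        have h6 := mul_le_mul_of_nonneg_left h5 (hu0 (y + -δ - s / (M / δ)))
        rw [Real.exp_neg] at h6
        have h7 := h6.trans this
        rwa [← div_eq_mul_inv, div_le_iff₀ (Real.exp_pos _)] at h7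
      have b2 : ∫ s in (Icc (-M) M)ᶜ, u (y + -δ - s / (M / δ)) * fejK s ≤
          ∫ s in (Icc (-M) M)ᶜ, C * fejK s := by
        refine setIntegral_mono_on (hint _ _).integrableOn
          (fejK_integrable.const_mul _).integrableOn measurableSet_Icc.compl fun s hs => ?_
        exact mul_le_mul_of_nonneg_right (hC _) (fejK_nonneg s)
      rw [integral_const_mul, ← hcM] at b1
      rw [integral_const_mul] at b2
      have hcMle : cM ≤ c := by
        have : 0 ≤ ∫ s in (Icc (-M) M)ᶜ, fejK s := integral_nonneg fejK_nonneg
        linarith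
      have h8 : u y * Real.exp (2 * δ) * cM ≤ u y * Real.exp (2 * δ) * c :=
        mul_le_mul_of_nonneg_left hcMle (mul_nonneg (hu0 _) (Real.exp_nonneg _))
      have h9 : ∫ s in (Icc (-M) M)ᶜ, fejK s = c - cM := by linarith
      rw [h9] at b2
      linarith
    have h10 : q * c * Real.exp (2 * δ) < u y * Real.exp (2 * δ) * c := by linarith
    have h11 : 0 < Real.exp (2 * δ) * c := by positivity
    have h12 : q * (Real.exp (2 * δ) * c) < u y * (Real.exp (2 * δ) * c) := by linarith
    exact lt_of_mul_lt_mul_right h12 h11.le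
  · have hM1 : Tendsto (fun M : ℝ => q * ∫ s in Icc (-M) M, fejK s) atTop (𝓝 (q * c)) :=
      fejK_Icc_tendsto.const_mul q
    have hlt : c < q * c := by nlinarith
    obtain ⟨M, hM, hMpos⟩ := ((hM1.eventually_const_lt hlt).and (eventually_gt_atTop 0)).exists
    set cM := ∫ s in Icc (-M) M, fejK s with hcM
    have hd := (hexp (q * cM) (-2)).eventually_const_lt hM
    obtain ⟨δ, hδ, hδpos⟩ := (hd.and self_mem_nhdsWithin).exists
    replace hδpos : 0 < δ := hδpos
    have hLpos : 0 < M / δ := by positivity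
    have hJ := (hlim (M / δ) hLpos).comp (tendsto_atTop_add_const_right atTop δ tendsto_id)
    filter_upwards [hJ.eventually_lt_const hδ] with y hy
    simp only [Function.comp, id] at hy
    have hge : u y * Real.exp (-2 * δ) * cM ≤ ∫ s, u (y + δ - s / (M / δ)) * fejK s := by
      have b1 : ∫ s in Icc (-M) M, (u y * Real.exp (-2 * δ)) * fejK s ≤
          ∫ s in Icc (-M) M, u (y + δ - s / (M / δ)) * fejK s := by
        refine setIntegral_mono_on (fejK_integrable.const_mul _).integrableOn
          (hint _ _).integrableOn measurableSet_Icc fun s hs => ?_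
        refine mul_le_mul_of_nonneg_right ?_ (fejK_nonneg s)
        have hs1 : -δ ≤ s / (M / δ) := by
          rw [le_div_iff₀ hLpos]; field_simp; linarith [hs.1]
        have hs2 : s / (M / δ) ≤ δ := by
          rw [div_le_iff₀ hLpos]; field_simp; linarith [hs.2]
        have := hmono y (y + δ - s / (M / δ)) (by linarith)
        have h5 : Real.exp (-2 * δ) ≤ Real.exp (y - (y + δ - s / (M / δ))) :=
          Real.exp_le_exp.mpr (by linarith)
        exact (mul_le_mul_of_nonneg_left h5 (hu0 y)).trans this
      rw [integral_const_mul, ← hcM] at b1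
      refine b1.trans (setIntegral_le_integral (hint _ _) (Eventually.of_forall fun s => ?_))
      exact mul_nonneg (hu0 _) (fejK_nonneg _)
    have hcMpos : 0 < cM := by
      by_contra h
      nlinarith
    have h11 : 0 < Real.exp (-2 * δ) * cM := by positivity
    have h12 : u y * (Real.exp (-2 * δ) * cM) < q * (Real.exp (-2 * δ) * cM) := by linarith
    exact lt_of_mul_lt_mul_right h12 h11.le

/-! ### The prime number theorem -/

open Chebyshev in
lemma psi_laplace (s : ℂ) (hs : 0 < s.re) :
    LSeries (fun n => ((ArithmeticFunction.vonMangoldt n : ℝ) : ℂ)) (1 + s) =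
    (1 + s) * ∫ t in Ioi (0:ℝ), ((psi (Real.exp t) * Real.exp (-t) : ℝ) : ℂ) *
      Complex.exp (-s * t) := by
  have hO : (fun n : ℕ ↦ ∑ k ∈ Finset.Icc 1 n, ArithmeticFunction.vonMangoldt k) =O[atTop]
      fun n ↦ (n : ℝ) ^ (1 : ℝ) := by
    refine Asymptotics.IsBigO.of_bound (Real.log 4 + 4) (Eventually.of_forall fun n => ?_)
    have h1 := psi_le_const_mul_self (x := (n : ℝ)) (Nat.cast_nonneg n)
    have h2 := psi_nonneg (n : ℝ)
    have h3 : psi (n : ℝ) = ∑ k ∈ Finset.Icc 1 n, ArithmeticFunction.vonMangoldt k := by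
      rw [psi, Nat.floor_natCast]
      rfl
    rw [← h3, Real.rpow_one, Real.norm_of_nonneg h2, Real.norm_of_nonneg (Nat.cast_nonneg n)]
    exact h1
  rw [LSeries_eq_mul_integral_of_nonneg _ zero_le_one (s := 1 + s) (by simpa using hs) hO
    (fun n => ArithmeticFunction.vonMangoldt_nonneg)]
  congr 1
  have himg : Real.exp '' Ioi 0 = Ioi 1 := by
    ext x
    constructor
    · rintro ⟨t, ht, rfl⟩
      exact Real.one_lt_exp_iff.mpr ht
    · intro hx
      exact ⟨Real.log x, Real.log_pos hx, Real.exp_log (zero_lt_one.trans hx)⟩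
  rw [← himg, integral_image_eq_integral_abs_deriv_smul measurableSet_Ioi
    (fun t _ => (Real.hasDerivAt_exp t).hasDerivWithinAt) Real.exp_injective.injOn]
  congr 1
  ext t
  have h3 : (∑ k ∈ Finset.Icc 1 ⌊Real.exp t⌋₊, ((ArithmeticFunction.vonMangoldt k : ℝ) : ℂ)) =
      (psi (Real.exp t) : ℂ) := by
    rw [psi]
    push_cast
    rfl
  rw [h3, abs_of_pos (Real.exp_pos t), Complex.real_smul]
  have h4 : ((Real.exp t : ℝ) : ℂ) ^ (-(1 + s + 1)) = Complex.exp (-(1 + s + 1) * t) := by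
    rw [Complex.cpow_def_of_ne_zero (by exact_mod_cast (Real.exp_pos t).ne'),
      ← Complex.ofReal_log (Real.exp_pos t).le, Real.log_exp, mul_comm]
  rw [h4]
  push_cast
  have h5 : Complex.exp t * Complex.exp (-(1 + s + 1) * t) =
      Complex.exp (-t) * Complex.exp (-s * t) := by
    rw [← Complex.exp_add, ← Complex.exp_add]
    congr 1
    ring
  linear_combination (psi (Real.exp t) : ℂ) * h5

lemma vonMangoldt_aux : ∃ F : ℂ → ℂ, ContinuousOn F {s | 1 ≤ s.re} ∧ ∀ s : ℂ, 1 < s.re →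
    LSeries (fun n => ((ArithmeticFunction.vonMangoldt n : ℝ) : ℂ)) s = F s + 1 / (s - 1) := by
  refine ⟨_, ArithmeticFunction.vonMangoldt.continuousOn_LFunctionResidueClassAux (1 : ZMod 1),
    fun s hs => ?_⟩
  have h := ArithmeticFunction.vonMangoldt.eqOn_LFunctionResidueClassAux (q := 1) (a := 1)
    isUnit_one hs
  have h2 : (fun n => ((ArithmeticFunction.vonMangoldt.residueClass (1 : ZMod 1) n : ℝ) : ℂ)) =
      (fun n => ((ArithmeticFunction.vonMangoldt n : ℝ) : ℂ)) := by
    ext n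
    congr 1
    rw [ArithmeticFunction.vonMangoldt.residueClass, indicator_of_mem]
    exact Subsingleton.elim _ _
  rw [h]
  simp only [h2]
  simp

open Chebyshev in
theorem psi_tendsto : Tendsto (fun x : ℝ => psi x / x) atTop (𝓝 1) := by
  set u : ℝ → ℝ := fun t => psi (Real.exp t) * Real.exp (-t) with hu
  have humeas : Measurable u := by
    have : Measurable psi := psi_mono.measurable
    fun_prop
  have hu0 : ∀ t, 0 ≤ u t := fun t => mul_nonneg (psi_nonneg _) (Real.exp_nonneg _)
  have huC : ∀ t, u t ≤ Real.log 4 + 4 := by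
    intro t
    have := psi_le_const_mul_self (Real.exp_nonneg t)
    simp only [hu]
    rw [Real.exp_neg, ← div_eq_mul_inv, div_le_iff₀ (Real.exp_pos t)]
    exact this
  have hneg : ∀ t, t ≤ 0 → u t = 0 := by
    intro t ht
    simp only [hu]
    rw [psi_eq_zero_of_le_one (Real.exp_le_one_iff.mpr ht), zero_mul]
  have hmono : ∀ s t, s ≤ t → u s * Real.exp (s - t) ≤ u t := by
    intro s t hst
    simp only [hu]
    rw [mul_assoc, ← Real.exp_add, show -s + (s - t) = -t by ring]
    exact mul_le_mul_of_nonneg_right (psi_mono (Real.exp_le_exp.mpr hst)) (Real.exp_nonneg _)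
  obtain ⟨F, hF, hFL⟩ := vonMangoldt_aux
  have hlim : Tendsto u atTop (𝓝 1) := by
    refine tauber_final u humeas _ hu0 huC hmono fun L hL0 => ?_
    refine tauber_limit u humeas _ hu0 huC hneg (fun s => (F (1 + s) - 1) / (1 + s)) ?_ ?_ L hL0
    · have hc : ContinuousOn (fun s : ℂ => F (1 + s)) {s | 0 ≤ s.re} := by
        refine hF.comp (by fun_prop) fun s hs => ?_
        have : (0:ℝ) ≤ s.re := hs
        simpa using this
      refine (hc.sub continuousOn_const).div (by fun_prop) fun s hs h => ?_
      have h1 : (0:ℝ) ≤ s.re := hs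
      have h2 := congrArg Complex.re h
      simp at h2
      linarith
    · intro s hs
      have hint1 : IntegrableOn (fun t : ℝ => Complex.exp (-s * t)) (Ioi 0) :=
        integrableOn_exp_mul_complex_Ioi (by simpa using hs) 0
      have hint2 : IntegrableOn (fun t : ℝ => (u t : ℂ) * Complex.exp (-s * t)) (Ioi 0) := by
        refine Integrable.bdd_mul (c := Real.log 4 + 4) hint1 ?_ ?_
        · exact (Complex.measurable_ofReal.comp humeas).aestronglyMeasurable
        · refine Eventually.of_forall fun t => ?_
          rw [Complex.norm_real, Real.norm_of_nonneg (hu0 t)]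
          exact huC t
      have h1 := psi_laplace s hs
      rw [hFL (1 + s) (by simpa using hs)] at h1
      have h2 : ∫ t in Ioi (0:ℝ), Complex.exp (-s * t) = 1 / s := by
        rw [integral_exp_mul_complex_Ioi (by simpa using hs)]
        simp
      have e : ∀ t : ℝ, ((u t - 1 : ℝ) : ℂ) * Complex.exp (-s * t) =
          (u t : ℂ) * Complex.exp (-s * t) - Complex.exp (-s * t) := by
        intro t
        push_cast
        ring
      simp_rw [e]
      rw [integral_sub hint2 hint1, h2]
      have hs0 : s ≠ 0 := by
        rintro rfl
        simp at hs
      have hs1 : 1 + s ≠ 0 := by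
        intro h
        have h3 := congrArg Complex.re h
        simp at h3
        linarith
      have h4 : ∫ t in Ioi (0:ℝ), (u t : ℂ) * Complex.exp (-s * t) =
          (F (1 + s) + 1 / (1 + s - 1)) / (1 + s) := by
        rw [h1, mul_div_cancel_left₀ _ hs1]
      rw [h4, add_sub_cancel_left]
      field_simp
      ring
  refine (hlim.comp Real.tendsto_log_atTop).congr' ?_
  filter_upwards [eventually_gt_atTop 0] with x hx
  simp only [hu, Function.comp, Real.exp_log hx, Real.exp_neg]
  rfl

open Chebyshev in
theorem pi_tendsto :
    Tendsto (fun x : ℝ => (Nat.primeCounting ⌊x⌋₊ : ℝ) / (x / Real.log x)) atTop (𝓝 1) := by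
  have h1 : Tendsto (fun x : ℝ => (psi x - theta x) / x) atTop (𝓝 0) := by
    have h := isBigO_psi_sub_theta_sqrt.trans_isLittleO
      (k := fun x : ℝ => x) ?_
    · exact h.tendsto_div_nhds_zero
    · refine (Asymptotics.isLittleO_iff_tendsto' ?_).mpr ?_
      · filter_upwards [eventually_gt_atTop 0] with x hx h
        exact absurd h hx.ne'
      · refine (Real.tendsto_sqrt_atTop.inv_tendsto_atTop).congr' ?_
        filter_upwards [eventually_gt_atTop 0] with x hx
        rw [Real.sqrt_div_self']
        simp
  have h2 : Tendsto (fun x : ℝ => theta x / x) atTop (𝓝 1) := by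
    have := psi_tendsto.sub h1
    rw [sub_zero] at this
    refine this.congr fun x => ?_
    ring
  have h3 : Tendsto (fun x : ℝ => (Nat.primeCounting ⌊x⌋₊ - theta x / Real.log x) /
      (x / Real.log x)) atTop (𝓝 0) := by
    have h := primeCounting_sub_theta_div_log_isBigO.trans_isLittleO
      (k := fun x : ℝ => x / Real.log x) ?_
    · exact h.tendsto_div_nhds_zero
    · refine (Asymptotics.isLittleO_iff_tendsto' ?_).mpr ?_
      · filter_upwards [eventually_gt_atTop 1] with x hx h
        have := Real.log_pos hx
        have : 0 < x / Real.log x := by positivity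
        linarith
      · refine (Real.tendsto_log_atTop.inv_tendsto_atTop).congr' ?_
        filter_upwards [eventually_gt_atTop 1] with x hx
        have := Real.log_pos hx
        simp only [Pi.inv_apply]
        field_simp
  have := h3.add h2
  rw [zero_add] at this
  refine this.congr' ?_
  filter_upwards [eventually_gt_atTop 1] with x hx
  have := Real.log_pos hx
  field_simp
  ring

/-! ### Combinatorial part -/

lemma sigma1_prime_mul {p m : ℕ} (hp : p.Prime) (hpm : ¬ p ∣ m) :
    sigma1 (p * m) = (p + 1) * sigma1 m := by
  unfold sigma1
  rw [ArithmeticFunction.isMultiplicative_sigma.map_mul_of_coprime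
    ((Nat.Prime.coprime_iff_not_dvd hp).mpr hpm)]
  congr 1
  rw [ArithmeticFunction.sigma_one_apply, hp.sum_divisors, add_comm]

/-- The finite set of multipliers. -/
noncomputable def mulSet (a b k₀ : ℕ) : Finset ℕ :=
  {m ∈ Finset.range k₀ | 0 < m ∧ b * sigma1 m = a * m ∧ a * m < b * k₀}

/-- The counted set. -/
noncomputable def cntSet (a b k₀ N : ℕ) : Finset ℕ :=
  {n ∈ Finset.Icc 1 N | |(b * sigma1 n : ℤ) - a * n| < b * k₀}

lemma cntSet_card_upper (a b k₀ N y : ℕ) (hb : 0 < b) (hab : b < a) (hy : 0 < y) :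
    (cntSet a b k₀ N).card ≤ ∑ m ∈ mulSet a b k₀, Nat.primeCounting (N / m) +
      (Nat.smoothNumbersUpTo N y).card + ∑ d ∈ Finset.Icc y N, N / d ^ 2 +
      N / y * (2 * (b * k₀)) := by
  have hsub : cntSet a b k₀ N ⊆
      (((mulSet a b k₀).biUnion fun m => (Nat.primesLE (N / m)).image (fun p => p * m)) ∪
      Nat.smoothNumbersUpTo N y) ∪
      ((Finset.Icc y N).biUnion fun d => {x ∈ Finset.Ioc 0 N | d ^ 2 ∣ x}) ∪
      (Finset.Ioc 0 (N / y) ×ˢ Finset.Ioc (-(b * k₀ : ℤ)) (b * k₀)).image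
        (fun z : ℕ × ℤ => z.1 * Int.toNat ((z.2 - (b * sigma1 z.1 : ℤ)) /
          ((b * sigma1 z.1 : ℤ) - (a * z.1 : ℤ)))) := by
    intro n hn
    simp only [cntSet, Finset.mem_filter, Finset.mem_Icc] at hn
    obtain ⟨⟨hn1, hnN⟩, hn2⟩ := hn
    by_cases hsm : n ∈ Nat.smoothNumbers y
    · exact Finset.mem_union_left _ (Finset.mem_union_left _ (Finset.mem_union_right _
        (Nat.mem_smoothNumbersUpTo.mpr ⟨hnN, hsm⟩)))
    rw [Nat.mem_smoothNumbers'] at hsm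
    push Not at hsm
    obtain ⟨p, hp, ⟨m, rfl⟩, hpy⟩ := hsm
    have hm0 : 0 < m := Nat.pos_of_ne_zero (by rintro rfl; simp at hn1)
    have hpN : p ≤ N := (Nat.le_mul_of_pos_right p hm0).trans hnN
    by_cases hpm : p ∣ m
    · refine Finset.mem_union_left _ (Finset.mem_union_right _ ?_)
      simp only [Finset.mem_biUnion, Finset.mem_filter, Finset.mem_Icc, Finset.mem_Ioc]
      refine ⟨p, ⟨hpy, hpN⟩, ⟨hn1, hnN⟩, ?_⟩
      rw [sq]
      exact Nat.mul_dvd_mul_left p hpm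
    have hσ := sigma1_prime_mul hp hpm
    rw [hσ] at hn2
    push_cast at hn2
    by_cases hreg : b * sigma1 m = a * m
    · refine Finset.mem_union_left _ (Finset.mem_union_left _ (Finset.mem_union_left _ ?_))
      simp only [Finset.mem_biUnion, Finset.mem_image, Nat.mem_primesLE]
      have hreg' : (b * sigma1 m : ℤ) = a * m := by exact_mod_cast hreg
      have e : (b * ((p + 1) * sigma1 m) : ℤ) - a * (p * m) = ((a * m : ℕ) : ℤ) := by
        push_cast
        linear_combination (p + 1 : ℤ) * hreg'
      rw [e, abs_of_nonneg (by positivity)] at hn2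
      have hlt : a * m < b * k₀ := by exact_mod_cast hn2
      refine ⟨m, ?_, p, ⟨(Nat.le_div_iff_mul_le hm0).mpr hnN, hp⟩, rfl⟩
      simp only [mulSet, Finset.mem_filter, Finset.mem_range]
      refine ⟨?_, hm0, hreg, hlt⟩
      by_contra h
      push Not at h
      have := Nat.mul_le_mul hab.le h
      omega
    · refine Finset.mem_union_right _ ?_
      simp only [Finset.mem_image, Finset.mem_product, Finset.mem_Ioc, Prod.exists]
      refine ⟨m, (b * ((p + 1) * sigma1 m) : ℤ) - a * (p * m), ⟨⟨hm0, ?_⟩, ?_, ?_⟩, ?_⟩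
      · rw [Nat.le_div_iff_mul_le hy]
        calc m * y ≤ m * p := Nat.mul_le_mul_left m hpy
          _ = p * m := mul_comm _ _
          _ ≤ N := hnN
      · exact (abs_lt.mp hn2).1
      · exact (abs_lt.mp hn2).2.le
      · have hne : (b * sigma1 m : ℤ) - a * m ≠ 0 := by
          intro h
          apply hreg
          have : (b * sigma1 m : ℤ) = a * m := by linarith
          exact_mod_cast this
        have e : (b * ((p + 1) * sigma1 m) : ℤ) - a * (p * m) - b * sigma1 m =
            (p : ℤ) * (b * sigma1 m - a * m) := by ring
        rw [e, Int.mul_ediv_cancel _ hne, Int.toNat_natCast, mul_comm]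
  refine (Finset.card_le_card hsub).trans ?_
  refine (Finset.card_union_le _ _).trans (add_le_add ?_ ?_)
  · refine (Finset.card_union_le _ _).trans (add_le_add ?_ ?_)
    · refine (Finset.card_union_le _ _).trans (add_le_add ?_ le_rfl)
      refine Finset.card_biUnion_le.trans (Finset.sum_le_sum fun m _ => ?_)
      refine Finset.card_image_le.trans ?_
      rw [Nat.primesLE_card_eq_primeCounting]
    · refine Finset.card_biUnion_le.trans (Finset.sum_le_sum fun d _ => ?_)
      rw [Nat.Ioc_filter_dvd_card_eq_div]
  · refine Finset.card_image_le.trans ?_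
    rw [Finset.card_product, Nat.card_Ioc, Int.card_Ioc, Nat.sub_zero]
    refine Nat.mul_le_mul_left _ ?_
    have : (b * k₀ : ℤ) - -(b * k₀ : ℤ) = ((2 * (b * k₀) : ℕ) : ℤ) := by push_cast; ring
    rw [this, Int.toNat_natCast]

lemma cntSet_card_lower (a b k₀ N : ℕ) :
    ∑ m ∈ mulSet a b k₀, Nat.primeCounting (N / m) ≤
      (cntSet a b k₀ N).card + (mulSet a b k₀).card * k₀ := by
  have h1 : ∀ m ∈ mulSet a b k₀, Nat.primeCounting (N / m) ≤
      (({p ∈ Nat.primesLE (N / m) | k₀ < p}).image (fun p => p * m)).card + k₀ := by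
    intro m hm
    have hm0 : 0 < m := (Finset.mem_filter.mp hm).2.1
    rw [Finset.card_image_of_injective _ (fun p q h => Nat.eq_of_mul_eq_mul_right hm0 h),
      ← Nat.primesLE_card_eq_primeCounting,
      ← Finset.card_filter_add_card_filter_not (s := Nat.primesLE (N / m)) (fun p => k₀ < p)]
    refine Nat.add_le_add_left ?_ _
    have : {p ∈ Nat.primesLE (N / m) | ¬ k₀ < p} ⊆ Finset.Icc 1 k₀ := by
      intro p hp
      simp only [Finset.mem_filter, Nat.mem_primesLE] at hp
      exact Finset.mem_Icc.mpr ⟨hp.1.2.one_le, not_lt.mp hp.2⟩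
    simpa using Finset.card_le_card this
  refine (Finset.sum_le_sum h1).trans ?_
  rw [Finset.sum_add_distrib, Finset.sum_const, smul_eq_mul]
  refine Nat.add_le_add_right ?_ _
  rw [← Finset.card_biUnion]
  · refine Finset.card_le_card fun n hn => ?_
    simp only [Finset.mem_biUnion, Finset.mem_image, Finset.mem_filter, Nat.mem_primesLE,
      mulSet, Finset.mem_range] at hn
    obtain ⟨m, ⟨hmk, hm0, hreg, hlt⟩, p, ⟨⟨hpN, hp⟩, hpk⟩, rfl⟩ := hn
    simp only [cntSet, Finset.mem_filter, Finset.mem_Icc]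
    refine ⟨⟨Nat.mul_pos hp.pos hm0, (Nat.le_div_iff_mul_le hm0).mp hpN⟩, ?_⟩
    have hpm : ¬ p ∣ m := fun h => by
      have := Nat.le_of_dvd hm0 h
      omega
    rw [sigma1_prime_mul hp hpm]
    have hreg' : (b * sigma1 m : ℤ) = a * m := by exact_mod_cast hreg
    push_cast
    have e : (b * ((p + 1) * sigma1 m) : ℤ) - a * (p * m) = ((a * m : ℕ) : ℤ) := by
      push_cast
      linear_combination (p + 1 : ℤ) * hreg'
    rw [e, abs_of_nonneg (by positivity)]
    exact_mod_cast hlt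
  · intro m hm m' hm' hne
    rw [Function.onFun, Finset.disjoint_left]
    intro n hn hn'
    simp only [Finset.mem_image, Finset.mem_filter, Nat.mem_primesLE] at hn hn'
    obtain ⟨p, ⟨⟨_, hp⟩, hpk⟩, rfl⟩ := hn
    obtain ⟨q, ⟨⟨_, hq⟩, hqk⟩, heq⟩ := hn'
    simp only [mulSet, Finset.coe_filter, Finset.mem_range, Set.mem_ofPred_eq] at hm hm'
    have hpq : p ∣ q * m' := heq ▸ Dvd.intro m rfl
    rcases hp.dvd_mul.mp hpq with h | h
    · have := (Nat.prime_dvd_prime_iff_eq hp hq).mp h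
      subst this
      exact hne (Nat.eq_of_mul_eq_mul_left hp.pos heq.symm)
    · have := Nat.le_of_dvd hm'.2.1 h
      omega

/-! ### Asymptotics -/

lemma pi_div_tendsto_zero :
    Tendsto (fun x : ℝ => (Nat.primeCounting ⌊x⌋₊ : ℝ) / x) atTop (𝓝 0) := by
  have h := pi_tendsto.mul Real.tendsto_log_atTop.inv_tendsto_atTop
  rw [mul_zero] at h
  refine h.congr' ?_
  filter_upwards [eventually_gt_atTop 1] with x hx
  have := Real.log_pos hx
  simp only [Pi.inv_apply]
  field_simp

lemma pi_div_tendsto (m : ℕ) (hm : 0 < m) :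
    Tendsto (fun x : ℝ => (Nat.primeCounting (⌊x⌋₊ / m) : ℝ) / (x / Real.log x)) atTop
      (𝓝 (1 / (m : ℝ))) := by
  have hm' : (0:ℝ) < m := by exact_mod_cast hm
  have hx : Tendsto (fun x : ℝ => x / m) atTop atTop := tendsto_id.atTop_div_const hm'
  have h1 := pi_tendsto.comp hx
  have hlog : Tendsto (fun x : ℝ => 1 + Real.log m * (Real.log (x / m))⁻¹) atTop (𝓝 1) := by
    have := ((Real.tendsto_log_atTop.comp hx).inv_tendsto_atTop.const_mul (Real.log m)).const_add 1
    rw [mul_zero, add_zero] at this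
    exact this
  have h2 := (h1.mul hlog).mul_const (1 / (m : ℝ))
  rw [one_mul, one_mul] at h2
  refine h2.congr' ?_
  filter_upwards [eventually_gt_atTop (m : ℝ), eventually_gt_atTop 1] with x hxm hx1
  have hl : 0 < Real.log (x / m) := Real.log_pos ((one_lt_div hm').mpr hxm)
  have hl2 : Real.log x = Real.log (x / m) + Real.log m := by
    rw [Real.log_div (by linarith) hm'.ne']
    ring
  simp only [Function.comp, Nat.floor_div_natCast]
  rw [hl2]
  have hx0 : 0 < x := by linarith
  field_simp

lemma smooth_tendsto (D : ℝ) (hD : 0 < D) (ε : ℝ) (hε : 0 < ε) : ∀ᶠ x : ℝ in atTop,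
    ((Nat.smoothNumbersUpTo ⌊x⌋₊ (⌊D * Real.log x⌋₊ + 1)).card : ℝ) ≤ ε * (x / Real.log x) := by
  have hz : Tendsto (fun x : ℝ => D * Real.log x) atTop atTop :=
    Real.tendsto_log_atTop.const_mul_atTop hD
  have h1 := (pi_div_tendsto_zero.comp hz).eventually_lt_const
    (show (0:ℝ) < 1 / (4 * D) by positivity)
  have h2 := (isLittleO_log_rpow_atTop (show (0:ℝ) < 1 / 4 by norm_num)).bound hε
  filter_upwards [h1, h2, eventually_gt_atTop 1] with x hx1 hx2 hx
  have hlog := Real.log_pos hx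
  have hx0 : 0 < x := by linarith
  simp only [Function.comp] at hx1
  rw [div_lt_iff₀ (by positivity)] at hx1
  have hpi : (Nat.primeCounting ⌊D * Real.log x⌋₊ : ℝ) ≤ Real.log x * (1 / 4) := by
    refine hx1.le.trans (le_of_eq ?_)
    field_simp
  have hc := Nat.smoothNumbersUpTo_card_le ⌊x⌋₊ (⌊D * Real.log x⌋₊ + 1)
  have hc2 : (Nat.primesBelow (⌊D * Real.log x⌋₊ + 1)).card =
      Nat.primeCounting ⌊D * Real.log x⌋₊ := Nat.primesLE_card_eq_primeCounting _
  rw [hc2] at hc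
  have hc3 : ((Nat.smoothNumbersUpTo ⌊x⌋₊ (⌊D * Real.log x⌋₊ + 1)).card : ℝ) ≤
      (2:ℝ) ^ (Nat.primeCounting ⌊D * Real.log x⌋₊) * (Nat.sqrt ⌊x⌋₊ : ℝ) := by
    exact_mod_cast hc
  have hs : (Nat.sqrt ⌊x⌋₊ : ℝ) ≤ x ^ (1 / 2 : ℝ) := by
    rw [← Real.sqrt_eq_rpow]
    exact Real.nat_sqrt_le_real_sqrt.trans (Real.sqrt_le_sqrt (Nat.floor_le hx0.le))
  have hp : (2:ℝ) ^ (Nat.primeCounting ⌊D * Real.log x⌋₊) ≤ x ^ (1 / 4 : ℝ) := by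
    rw [Real.rpow_def_of_pos hx0]
    calc (2:ℝ) ^ (Nat.primeCounting ⌊D * Real.log x⌋₊)
        ≤ (Real.exp 1) ^ (Nat.primeCounting ⌊D * Real.log x⌋₊) := by
          gcongr
          linarith [Real.add_one_le_exp (1:ℝ)]
      _ = Real.exp (Nat.primeCounting ⌊D * Real.log x⌋₊) := by
          rw [← Real.exp_nat_mul, mul_one]
      _ ≤ _ := Real.exp_le_exp.mpr hpi
  rw [Real.norm_of_nonneg hlog.le, Real.norm_of_nonneg (by positivity)] at hx2
  have hmul : x ^ (1 / 4 : ℝ) * x ^ (1 / 2 : ℝ) * x ^ (1 / 4 : ℝ) = x := by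
    rw [← Real.rpow_add hx0, ← Real.rpow_add hx0]
    norm_num
  calc _ ≤ x ^ (1 / 4 : ℝ) * x ^ (1 / 2 : ℝ) := hc3.trans (by gcongr)
    _ ≤ ε * (x / Real.log x) := by
      rw [← mul_div_assoc, le_div_iff₀ hlog]
      calc _ ≤ x ^ (1 / 4 : ℝ) * x ^ (1 / 2 : ℝ) * (ε * x ^ (1 / 4 : ℝ)) := by gcongr
        _ = ε * (x ^ (1 / 4 : ℝ) * x ^ (1 / 2 : ℝ) * x ^ (1 / 4 : ℝ)) := by ring
        _ = _ := by rw [hmul]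

lemma sum_sq_le (N y : ℕ) (hy : 0 < y) :
    ((∑ d ∈ Finset.Icc y N, N / d ^ 2 : ℕ) : ℝ) ≤ N * (2 / y) := by
  obtain ⟨k, rfl⟩ : ∃ k, y = k + 1 := ⟨y - 1, by omega⟩
  have h := sum_Ioo_inv_sq_le (α := ℝ) k (N + 1)
  have e : Finset.Ioo k (N + 1) = Finset.Icc (k + 1) N := by
    ext i
    simp only [Finset.mem_Ioo, Finset.mem_Icc]
    omega
  rw [e] at h
  push_cast
  calc _ ≤ ∑ d ∈ Finset.Icc (k + 1) N, (N : ℝ) * ((d : ℝ) ^ 2)⁻¹ := by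
        refine Finset.sum_le_sum fun d _ => ?_
        refine Nat.cast_div_le.trans (le_of_eq ?_)
        push_cast
        rfl
    _ = N * ∑ d ∈ Finset.Icc (k + 1) N, ((d : ℝ) ^ 2)⁻¹ := by rw [Finset.mul_sum]
    _ ≤ _ := by gcongr

lemma cntSet_tendsto (a b k₀ : ℕ) (hb : 0 < b) (hab : b < a) :
    Tendsto (fun x : ℝ => ((cntSet a b k₀ ⌊x⌋₊).card : ℝ) / (x / Real.log x)) atTop
      (𝓝 (∑ m ∈ mulSet a b k₀, 1 / (m : ℝ))) := by
  set R : ℝ → ℝ := fun x => ∑ m ∈ mulSet a b k₀, (Nat.primeCounting (⌊x⌋₊ / m) : ℝ) with hR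
  have hRlim : Tendsto (fun x => R x / (x / Real.log x)) atTop
      (𝓝 (∑ m ∈ mulSet a b k₀, 1 / (m : ℝ))) := by
    simp only [hR, Finset.sum_div]
    exact tendsto_finsetSum _ fun m hm => pi_div_tendsto m (Finset.mem_filter.mp hm).2.1
  have hdiff : Tendsto (fun x => (((cntSet a b k₀ ⌊x⌋₊).card : ℝ) - R x) / (x / Real.log x)) atTop
      (𝓝 0) := by
    rw [Metric.tendsto_nhds]
    intro ε hε
    set Q : ℝ := 2 + 2 * (b * k₀) with hQ
    have hQpos : 0 < Q := by positivity
    have hDpos : 0 < 4 * Q / ε := by positivity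
    have h1 := smooth_tendsto (4 * Q / ε) hDpos (ε / 4) (by positivity)
    have h2 : ∀ᶠ x : ℝ in atTop, Real.log x * ((mulSet a b k₀).card * k₀ : ℝ) < ε * x := by
      have hl : Tendsto (fun x : ℝ => Real.log x / x * ((mulSet a b k₀).card * k₀ : ℝ))
          atTop (𝓝 (0 * ((mulSet a b k₀).card * k₀ : ℝ))) :=
        (Real.isLittleO_log_id_atTop.tendsto_div_nhds_zero).mul_const _
      rw [zero_mul] at hl
      filter_upwards [hl.eventually_lt_const hε, eventually_gt_atTop 0] with x hx hx0
      have := mul_lt_mul_of_pos_right hx hx0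
      refine lt_of_eq_of_lt ?_ this
      field_simp
    filter_upwards [h1, h2, eventually_gt_atTop 1] with x hx1 hx2 hx
    have hlog := Real.log_pos hx
    have hx0 : 0 < x := by linarith
    have hxl : 0 < x / Real.log x := by positivity
    set y : ℕ := ⌊4 * Q / ε * Real.log x⌋₊ + 1 with hy
    have hypos : 0 < y := Nat.succ_pos _
    have hyge : 4 * Q / ε * Real.log x ≤ y := by
      rw [hy]
      push_cast
      exact (Nat.lt_floor_add_one _).le
    have hup : ((cntSet a b k₀ ⌊x⌋₊).card : ℝ) ≤ R x +
        (Nat.smoothNumbersUpTo ⌊x⌋₊ y).card + ((∑ d ∈ Finset.Icc y ⌊x⌋₊, ⌊x⌋₊ / d ^ 2 : ℕ) : ℝ) +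
        ((⌊x⌋₊ / y : ℕ) : ℝ) * (2 * (b * k₀)) := by
      have := cntSet_card_upper a b k₀ ⌊x⌋₊ y hb hab hypos
      simp only [hR]
      exact_mod_cast this
    have hlo : R x ≤ (cntSet a b k₀ ⌊x⌋₊).card + ((mulSet a b k₀).card * k₀ : ℝ) := by
      have := cntSet_card_lower a b k₀ ⌊x⌋₊
      simp only [hR]
      exact_mod_cast this
    have hyR : (0:ℝ) < y := by exact_mod_cast hypos
    have hfl : (⌊x⌋₊ : ℝ) ≤ x := Nat.floor_le hx0.le
    have hb1 : ((∑ d ∈ Finset.Icc y ⌊x⌋₊, ⌊x⌋₊ / d ^ 2 : ℕ) : ℝ) ≤ x * (2 / y) :=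
      (sum_sq_le _ _ hypos).trans (by gcongr)
    have hb2 : ((⌊x⌋₊ / y : ℕ) : ℝ) ≤ x / y := Nat.cast_div_le.trans (by gcongr)
    have hb3 : x * (2 / y) + x / y * (2 * (b * k₀)) ≤ ε / 4 * (x / Real.log x) := by
      have : x * (2 / y) + x / y * (2 * (b * k₀)) = Q * x / y := by rw [hQ]; ring
      rw [this, div_le_iff₀ hyR]
      calc Q * x = ε / 4 * (x / Real.log x) * (4 * Q / ε * Real.log x) := by field_simp
        _ ≤ _ := by gcongr
    have hb4 : ((⌊x⌋₊ / y : ℕ) : ℝ) * (2 * (b * k₀)) ≤ x / y * (2 * (b * k₀)) := by gcongr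
    rw [Real.dist_eq, sub_zero, abs_div, abs_of_pos hxl, div_lt_iff₀ hxl, abs_lt]
    have hεx : 0 < ε * (x / Real.log x) := by positivity
    constructor
    · have : ((mulSet a b k₀).card * k₀ : ℝ) < ε * (x / Real.log x) := by
        rw [← mul_div_assoc, lt_div_iff₀ hlog]
        linarith
      linarith
    · linarith
  have := hdiff.add hRlim
  rw [zero_add] at this
  refine this.congr fun x => ?_
  rw [← add_div, sub_add_cancel]

theorem stmt_12 (a b : ℕ) (ha : 0 < a) (hb : 0 < b) (hab : Nat.Coprime a b)
    (ℓ : ℝ) (hℓab : ℓ = (a : ℝ) / b) (hℓ : 1 < ℓ) (k₀ : ℕ) (hk₀ : 1 ≤ k₀) :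
    Filter.Tendsto (fun x : ℝ =>
        ({n : ℕ | 1 ≤ n ∧ (n : ℝ) ≤ x ∧ |(sigma1 n : ℝ) - ℓ * n| < (k₀ : ℝ)}.ncard : ℝ) /
          (x / Real.log x))
      Filter.atTop
      (nhds (∑' m : {m : ℕ // 0 < m ∧ (sigma1 m : ℝ) = ℓ * m ∧ b ∣ m ∧
          (m : ℝ) < (k₀ : ℝ) / ℓ}, 1 / ((m : ℕ) : ℝ))) := by
  have hbR : (0:ℝ) < b := by exact_mod_cast hb
  have haR : (0:ℝ) < a := by exact_mod_cast ha
  have hba : b < a := by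
    rw [hℓab, one_lt_div hbR] at hℓ
    exact_mod_cast hℓ
  have hset : {m : ℕ | 0 < m ∧ (sigma1 m : ℝ) = ℓ * m ∧ b ∣ m ∧ (m : ℝ) < (k₀ : ℝ) / ℓ} =
      (mulSet a b k₀ : Set ℕ) := by
    ext m
    have e1 : (sigma1 m : ℝ) = ℓ * m ↔ b * sigma1 m = a * m := by
      rw [hℓab, div_mul_eq_mul_div, eq_div_iff hbR.ne', mul_comm]
      exact_mod_cast Iff.rfl
    have e2 : (m : ℝ) < (k₀ : ℝ) / ℓ ↔ a * m < b * k₀ := by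
      rw [hℓab, div_div_eq_mul_div, lt_div_iff₀ haR, mul_comm (m : ℝ), mul_comm (k₀ : ℝ)]
      exact_mod_cast Iff.rfl
    simp only [Set.mem_ofPred_eq, mulSet, Finset.coe_filter, Finset.mem_range, e1, e2]
    constructor
    · rintro ⟨h1, h2, h3, h4⟩
      refine ⟨?_, h1, h2, h4⟩
      by_contra h
      push Not at h
      have := Nat.mul_le_mul hba.le h
      omega
    · rintro ⟨h0, h1, h2, h4⟩
      exact ⟨h1, h2, hab.symm.dvd_of_dvd_mul_left (h2 ▸ Dvd.intro _ rfl), h4⟩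
  have hsum : (∑' m : {m : ℕ // 0 < m ∧ (sigma1 m : ℝ) = ℓ * m ∧ b ∣ m ∧
      (m : ℝ) < (k₀ : ℝ) / ℓ}, 1 / ((m : ℕ) : ℝ)) = ∑ m ∈ mulSet a b k₀, 1 / (m : ℝ) := by
    rw [← Finset.tsum_subtype']
    change (∑' m : {m : ℕ | 0 < m ∧ (sigma1 m : ℝ) = ℓ * m ∧ b ∣ m ∧
      (m : ℝ) < (k₀ : ℝ) / ℓ}, 1 / ((m : ℕ) : ℝ)) = _
    rw [hset]
  rw [hsum]
  refine (cntSet_tendsto a b k₀ hb hba).congr' ?_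
  filter_upwards [eventually_gt_atTop 0] with x hx
  congr 2
  rw [← Set.ncard_coe_finset]
  congr 1
  ext n
  simp only [cntSet, Finset.coe_filter, Finset.mem_Icc, Set.mem_ofPred_eq, Nat.le_floor_iff hx.le,
    and_assoc]
  have e : |(sigma1 n : ℝ) - ℓ * n| < (k₀ : ℝ) ↔ |(b * sigma1 n : ℤ) - a * n| < b * k₀ := by
    have e1 : (b : ℝ) * |(sigma1 n : ℝ) - ℓ * n| = |(b * sigma1 n : ℝ) - a * n| := by
      rw [← abs_of_pos hbR, ← abs_mul, abs_of_pos hbR, hℓab]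
      congr 1
      field_simp
    rw [← mul_lt_mul_iff_right₀ hbR, e1]
    exact_mod_cast Iff.rfl
  rw [e]
end

section
/- Let c ∈ (0, 1/3) and let k : [1,∞) → (0,∞) be an increasing unbounded function with k(y) ≤ y^c for all y ≥ 1. Suppose ℓ = a/b ∈ Σ with a, b coprime positive integers. Then limsup_{x→∞} #W(ℓ;k;x) / (x / log x) ≤ ∑_{m ≥ 1 : σ(m) = ℓ·m} 1/m. -/
/-- `#W(ℓ;k;x)`: the number of `(ℓ;k)`-within-perfect numbers up to `x`. -/
noncomputable def withinPerfectCount (ℓ : ℝ) (k : ℝ → ℝ) (x : ℝ) : ℕ :=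
  {n : ℕ | 1 ≤ n ∧ (n : ℝ) ≤ x ∧ |(sigma1 n : ℝ) - ℓ * n| < k n}.ncard


section PNT
open Complex MeasureTheory Filter Set Topology

noncomputable def pntF (v : ℝ) : ℝ := Chebyshev.psi (Real.exp v) * Real.exp (-v) - 1

lemma pntF_bound {v : ℝ} : |pntF v| ≤ Real.log 4 + 5 := by
  have h1 := Chebyshev.psi_le_const_mul_self (Real.exp_pos v).le
  have h0 := Chebyshev.psi_nonneg (Real.exp v)
  have h2 : Chebyshev.psi (Real.exp v) * Real.exp (-v) ≤ Real.log 4 + 4 := by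
    rw [Real.exp_neg, ← div_eq_mul_inv, div_le_iff₀ (Real.exp_pos v)]
    exact h1
  have h3 : 0 ≤ Chebyshev.psi (Real.exp v) * Real.exp (-v) := by positivity
  have h4 : 0 < Real.log 4 := Real.log_pos (by norm_num)
  unfold pntF
  rw [abs_le]
  constructor <;> linarith

lemma pntF_meas : Measurable pntF := by
  unfold pntF
  exact ((Chebyshev.psi_mono.measurable.comp Real.measurable_exp).mul
    (Real.measurable_exp.comp measurable_neg)).sub_const 1

lemma pnt_G : ∃ G : ℂ → ℂ, ContinuousOn G {s | 1 ≤ s.re} ∧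
    ∀ s : ℂ, 1 < s.re → G s = LSeries (fun n => (ArithmeticFunction.vonMangoldt n : ℂ)) s - 1 / (s - 1) := by
  refine ⟨_, ArithmeticFunction.vonMangoldt.continuousOn_LFunctionResidueClassAux (1 : ZMod 1), ?_⟩
  intro s hs
  have := ArithmeticFunction.vonMangoldt.eqOn_LFunctionResidueClassAux (q := 1) (a := 1) isUnit_one hs
  rw [this]
  beta_reduce
  congr 1
  · apply LSeries_congr
    intro n _
    simp [ArithmeticFunction.vonMangoldt.residueClass, Set.indicator]
    intro h
    exact absurd (Subsingleton.elim _ _) h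
  · simp

lemma pnt_exp_integral {z : ℂ} (hz : 0 < z.re) :
    ∫ v in Ioi (0:ℝ), Complex.exp (-z * v) = 1 / z := by
  rw [integral_exp_mul_complex_Ioi (by simpa using hz)]
  simp

lemma pnt_exp_integrable {z : ℂ} (hz : 0 < z.re) :
    IntegrableOn (fun v : ℝ => Complex.exp (-z * v)) (Ioi (0:ℝ)) :=
  integrableOn_exp_mul_complex_Ioi (by simpa using hz) 0

lemma pntF_integrable {z : ℂ} (hz : 0 < z.re) :
    IntegrableOn (fun v : ℝ => (pntF v : ℂ) * Complex.exp (-z * v)) (Ioi (0:ℝ)) := by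
  refine Integrable.bdd_mul (c := Real.log 4 + 5) (pnt_exp_integrable hz) ?_ ?_
  · exact (Complex.measurable_ofReal.comp pntF_meas).aestronglyMeasurable
  · refine Eventually.of_forall fun v => ?_
    simpa using pntF_bound

lemma pnt_H : ∃ H : ℂ → ℂ, ContinuousOn H {s | 1 ≤ s.re} ∧
    ∀ s : ℂ, 1 < s.re → H s = ∫ v in Ioi (0:ℝ), (pntF v : ℂ) * Complex.exp (-(s-1) * v) := by
  obtain ⟨G, hG, hGe⟩ := pnt_G
  refine ⟨fun s => (G s - 1) / s, ?_, ?_⟩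
  · refine (hG.sub continuousOn_const).div continuousOn_id ?_
    intro s hs h0
    change s = 0 at h0
    rw [h0] at hs
    norm_num at hs
  intro s hs
  have hs0 : s ≠ 0 := by
    intro h; rw [h] at hs; norm_num at hs
  have hs1 : s - 1 ≠ 0 := by
    intro h; have := congrArg Complex.re h; simp at this; linarith
  have hre : 0 < (s - 1).re := by simp; linarith
  have hL := LSeries_eq_mul_integral_of_nonneg (fun n => ArithmeticFunction.vonMangoldt n)
    (r := 1) zero_le_one hs ?_ (fun n => ArithmeticFunction.vonMangoldt_nonneg)
  · have e1 : ∫ t in Set.Ioi (1 : ℝ), (∑ k ∈ Finset.Icc 1 ⌊t⌋₊, ((ArithmeticFunction.vonMangoldt k : ℝ) : ℂ)) * (t:ℂ) ^ (-(s + 1))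
        = ∫ v in Ioi (0:ℝ), ((Chebyshev.psi (Real.exp v) * Real.exp (-v) : ℝ) : ℂ) * Complex.exp (-(s-1) * v) := by
      rw [← Real.exp_zero, ← integral_comp_exp_Ioi]
      apply integral_congr_ae
      refine Eventually.of_forall fun v => ?_
      have : (((Real.exp v : ℝ)) : ℂ) ^ (-(s+1)) = Complex.exp (-(s+1) * v) := by
        rw [Complex.cpow_def_of_ne_zero (by exact_mod_cast (Real.exp_pos v).ne'), ← Complex.ofReal_log (Real.exp_pos v).le, Real.log_exp]
        ring_nf
      beta_reduce
      rw [this]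
      have h2 : (∑ k ∈ Finset.Icc 1 ⌊Real.exp v⌋₊, ((ArithmeticFunction.vonMangoldt k : ℝ) : ℂ)) = ((Chebyshev.psi (Real.exp v) : ℝ) : ℂ) := by
        rw [Chebyshev.psi]; push_cast; rfl
      rw [h2, Complex.real_smul]
      push_cast
      rw [mul_left_comm, ← Complex.exp_add, mul_assoc, ← Complex.exp_add]
      ring_nf
    rw [e1] at hL
    have e2 : ∫ v in Ioi (0:ℝ), (pntF v : ℂ) * Complex.exp (-(s-1) * v) =
       (∫ v in Ioi (0:ℝ), ((Chebyshev.psi (Real.exp v) * Real.exp (-v) : ℝ) : ℂ) * Complex.exp (-(s-1) * v)) - 1/(s-1) := by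
      rw [← pnt_exp_integral hre, eq_sub_iff_add_eq, ← integral_add (pntF_integrable hre) (pnt_exp_integrable hre)]
      apply integral_congr_ae
      refine Eventually.of_forall fun v => ?_
      simp only [pntF]
      push_cast
      ring
    beta_reduce
    rw [e2, hGe s hs, hL]
    field_simp
    ring
  · refine Asymptotics.IsBigO.of_bound (Real.log 4 + 4) (Eventually.of_forall fun n => ?_)
    have := Chebyshev.psi_le_const_mul_self (Nat.cast_nonneg n : (0:ℝ) ≤ n)
    rw [Chebyshev.psi, Nat.floor_natCast] at this
    rw [Real.norm_of_nonneg (Finset.sum_nonneg fun _ _ => ArithmeticFunction.vonMangoldt_nonneg), Real.rpow_one, Real.norm_of_nonneg (Nat.cast_nonneg n)]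
    exact this

noncomputable def fejer (r : ℝ) : ℝ := 2 * (1 - Real.cos r) / r ^ 2

lemma fejer_nonneg (r : ℝ) : 0 ≤ fejer r := by
  unfold fejer
  have := Real.cos_le_one r
  apply div_nonneg <;> nlinarith [sq_nonneg r]

lemma fejer_le (r : ℝ) : fejer r ≤ 5 * (1 + r ^ 2)⁻¹ := by
  unfold fejer
  rcases eq_or_ne r 0 with rfl | hr
  · simp
  have h1 := Real.one_sub_sq_div_two_le_cos (x := r)
  have h2 := Real.neg_one_le_cos r
  have h3 : 0 < r ^ 2 := by positivity
  rw [← div_eq_mul_inv, div_le_div_iff₀ h3 (by positivity)]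
  nlinarith [mul_nonneg h3.le (by linarith : 0 ≤ 1 + Real.cos r)]

lemma fejer_meas : Measurable fejer := by
  unfold fejer
  exact ((measurable_const.sub Real.measurable_cos).const_mul 2).div (measurable_id.pow_const 2)

lemma fejer_integrable : Integrable fejer := by
  refine Integrable.mono' (integrable_inv_one_add_sq.const_mul 5) fejer_meas.aestronglyMeasurable ?_
  refine Eventually.of_forall fun r => ?_
  rw [Real.norm_of_nonneg (fejer_nonneg r)]
  exact fejer_le r

lemma fejer_eq {r : ℝ} (hr : r ≠ 0) :
    ∫ u in (-1:ℝ)..1, ((1 - |u| : ℝ) : ℂ) * Complex.exp (-(Complex.I * r) * u) = fejer r := by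
  set z : ℂ := -(Complex.I * r) with hz
  have hz0 : z ≠ 0 := by simp [hz, hr]
  have hcont : Continuous fun u : ℝ => ((1 - |u| : ℝ) : ℂ) * Complex.exp (z * u) := by fun_prop
  rw [← intervalIntegral.integral_add_adjacent_intervals (b := 0)
    (hcont.intervalIntegrable _ _) (hcont.intervalIntegrable _ _)]
  have hlin : ∀ u : ℝ, HasDerivAt (fun u : ℝ => Complex.exp (z * u)) (Complex.exp (z * u) * z) u := by
    intro u
    have : HasDerivAt (fun u : ℝ => z * (u : ℂ)) z u := by
      simpa using (Complex.ofRealCLM.hasDerivAt (x := u)).const_mul z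
    exact this.cexp
  have hof : ∀ u : ℝ, HasDerivAt (fun u : ℝ => (u : ℂ)) 1 u := fun u => by
    simpa using (hasDerivAt_id u).ofReal_comp
  have e1 : ∫ u in (-1:ℝ)..0, ((1 - |u| : ℝ) : ℂ) * Complex.exp (z * u)
      = (1 / z - 1 / z ^ 2) + Complex.exp (-z) / z ^ 2 := by
    have : ∫ u in (-1:ℝ)..0, ((1 - |u| : ℝ) : ℂ) * Complex.exp (z * u)
      = ∫ u in (-1:ℝ)..0, (1 + (u : ℂ)) * Complex.exp (z * u) := by
      apply intervalIntegral.integral_congr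
      intro u hu
      rw [uIcc_of_le (by norm_num)] at hu
      simp only [abs_of_nonpos hu.2]
      push_cast; ring
    rw [this, intervalIntegral.integral_eq_sub_of_hasDerivAt
      (f := fun u : ℝ => ((1 + (u:ℂ)) / z - 1 / z ^ 2) * Complex.exp (z * u))]
    · simp; ring
    · intro u _
      have h := ((((hof u).const_add 1).div_const z).sub_const (1 / z ^ 2)).mul (hlin u)
      refine h.congr_deriv ?_
      field_simp
      ring
    · apply Continuous.intervalIntegrable; fun_prop
  have e2 : ∫ u in (0:ℝ)..1, ((1 - |u| : ℝ) : ℂ) * Complex.exp (z * u)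
      = Complex.exp z / z ^ 2 - (1 / z + 1 / z ^ 2) := by
    have : ∫ u in (0:ℝ)..1, ((1 - |u| : ℝ) : ℂ) * Complex.exp (z * u)
      = ∫ u in (0:ℝ)..1, (1 - (u : ℂ)) * Complex.exp (z * u) := by
      apply intervalIntegral.integral_congr
      intro u hu
      rw [uIcc_of_le (by norm_num)] at hu
      simp only [abs_of_nonneg hu.1]
      push_cast; ring
    rw [this, intervalIntegral.integral_eq_sub_of_hasDerivAt
      (f := fun u : ℝ => ((1 - (u:ℂ)) / z + 1 / z ^ 2) * Complex.exp (z * u))]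
    · simp; ring
    · intro u _
      have h := ((((hof u).const_sub 1).div_const z).add_const (1 / z ^ 2)).mul (hlin u)
      refine h.congr_deriv ?_
      field_simp
      ring
    · apply Continuous.intervalIntegrable; fun_prop
  rw [e1, e2]
  have h2 : Complex.exp z + Complex.exp (-z) = 2 * Complex.cos r := by
    rw [Complex.cos, hz]
    ring_nf
  have h3 : z ^ 2 = - (r : ℂ) ^ 2 := by
    rw [hz, neg_sq, mul_pow, Complex.I_sq]; ring
  have hr' : (r : ℂ) ≠ 0 := by exact_mod_cast hr
  unfold fejer
  push_cast
  have : (1 / z - 1 / z ^ 2) + Complex.exp (-z) / z ^ 2 + (Complex.exp z / z ^ 2 - (1 / z + 1 / z ^ 2))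
    = ((Complex.exp z + Complex.exp (-z)) - 2) / z ^ 2 := by ring
  rw [this, h2, h3]
  field_simp
  ring

lemma fejer_shift_integrable {l : ℝ} (hl : 0 < l) (y : ℝ) :
    Integrable (fun v => fejer (l * (v - y))) := by
  have h := (fejer_integrable.comp_mul_left' hl.ne')
  exact h.comp_sub_right y

/-- the smoothed identity for `δ > 0` -/
lemma pnt_fubini {H : ℂ → ℂ}
    (hHe : ∀ s : ℂ, 1 < s.re → H s = ∫ v in Ioi (0:ℝ), (pntF v : ℂ) * Complex.exp (-(s-1) * v))
    {l δ : ℝ} (hl : 0 < l) (hδ : 0 < δ) (y : ℝ) :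
    ∫ u in (-1:ℝ)..1, ((1 - |u| : ℝ) : ℂ) * Complex.exp (Complex.I * l * y * u) * H (1 + δ + Complex.I * l * u)
     = ∫ v in Ioi (0:ℝ), ((pntF v * Real.exp (-δ * v) * fejer (l * (v - y)) : ℝ) : ℂ) := by
  have e1 : ∀ u : ℝ, ((1 - |u| : ℝ) : ℂ) * Complex.exp (Complex.I * l * y * u) * H (1 + δ + Complex.I * l * u)
     = ∫ v in Ioi (0:ℝ), ((1 - |u| : ℝ) : ℂ) * Complex.exp (Complex.I * l * y * u) *
        ((pntF v : ℂ) * Complex.exp (-(δ + Complex.I * l * u) * v)) := by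
    intro u
    rw [hHe _ (by simpa using hδ), ← integral_const_mul]
    congr 1
    ext v
    ring_nf
  simp_rw [e1]
  rw [intervalIntegral.integral_of_le (by norm_num), integral_integral_swap]
  · apply integral_congr_ae
    have hne : ∀ᵐ v ∂(volume.restrict (Ioi (0:ℝ))), v ≠ y := by
      apply ae_restrict_of_ae
      simp [ae_iff]
    filter_upwards [hne] with v hv
    have hr : l * (v - y) ≠ 0 := mul_ne_zero hl.ne' (sub_ne_zero.mpr hv)
    push_cast
    rw [← fejer_eq hr, ← intervalIntegral.integral_of_le (by norm_num), ← intervalIntegral.integral_const_mul]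
    apply intervalIntegral.integral_congr
    intro u _
    simp only
    have : Complex.exp (-(δ + Complex.I * l * u) * v) = Complex.exp (-δ * v) * Complex.exp (-(Complex.I * l * u) * v) := by
      rw [← Complex.exp_add]; ring_nf
    rw [this]
    have h2 : Complex.exp (-(Complex.I * ((l * (v - y) : ℝ))) * u) = Complex.exp (Complex.I * l * y * u) * Complex.exp (-(Complex.I * l * u) * v) := by
      rw [← Complex.exp_add]; push_cast; ring_nf
    rw [h2]
    push_cast
    ring
  · have hb : Integrable (fun p : ℝ × ℝ => (1:ℝ) * ((Real.log 4 + 5) * Real.exp (-δ * p.2)))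
        ((volume.restrict (Ioc (-1:ℝ) 1)).prod (volume.restrict (Ioi (0:ℝ)))) := by
      apply Integrable.mul_prod (f := fun _ => (1:ℝ)) (g := fun v => (Real.log 4 + 5) * Real.exp (-δ * v))
      · exact integrable_const _
      · exact (exp_neg_integrableOn_Ioi 0 hδ).const_mul _
    refine Integrable.mono hb ?_ ?_
    · apply Measurable.aestronglyMeasurable
      have := pntF_meas
      simp only [Function.uncurry_def]
      fun_prop
    · have : ∀ᵐ p ∂((volume.restrict (Ioc (-1:ℝ) 1)).prod (volume.restrict (Ioi (0:ℝ)))), p ∈ (Ioc (-1:ℝ) 1) ×ˢ (Ioi (0:ℝ)) := by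
        rw [Measure.prod_restrict]
        exact ae_restrict_mem (measurableSet_Ioc.prod measurableSet_Ioi)
      filter_upwards [this] with p hp
      obtain ⟨u, v⟩ := p
      have hu : |u| ≤ 1 := abs_le.mpr ⟨hp.1.1.le, hp.1.2⟩
      simp only [Function.uncurry_apply_pair, norm_mul, Complex.norm_exp, Complex.norm_real, Real.norm_eq_abs]
      have h4 : 0 < Real.log 4 := Real.log_pos (by norm_num)
      rw [abs_of_nonneg (by linarith : 0 ≤ 1 - |u|), abs_of_nonneg (by linarith : 0 ≤ Real.log 4 + 5), Real.abs_exp]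
      have a1 : (Complex.I * l * y * u).re = 0 := by simp
      have a2 : (-(δ + Complex.I * l * u) * v).re = -δ * v := by simp
      rw [a1, a2, Real.exp_zero, mul_one, abs_one]
      gcongr
      · linarith [abs_nonneg u]
      · exact pntF_bound

lemma pnt_limit {H : ℂ → ℂ} (hH : ContinuousOn H {s | 1 ≤ s.re})
    (hHe : ∀ s : ℂ, 1 < s.re → H s = ∫ v in Ioi (0:ℝ), (pntF v : ℂ) * Complex.exp (-(s-1) * v))
    {l : ℝ} (hl : 0 < l) (y : ℝ) :
    ∫ u in (-1:ℝ)..1, ((1 - |u| : ℝ) : ℂ) * Complex.exp (Complex.I * l * y * u) * H (1 + Complex.I * l * u)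
     = ∫ v in Ioi (0:ℝ), ((pntF v * fejer (l * (v - y)) : ℝ) : ℂ) := by
  have hmem : ∀ (δ u : ℝ), 0 ≤ δ → (1 + (δ:ℂ) + Complex.I * l * u) ∈ {s : ℂ | 1 ≤ s.re} := by
    intro δ u hδ
    simpa using hδ
  have hmem0 : ∀ (u : ℝ), (1 + Complex.I * l * u) ∈ {s : ℂ | 1 ≤ s.re} := by
    intro u
    simp
  -- joint continuity
  have hjoint : ContinuousOn (fun p : ℝ × ℝ => H (1 + (p.1:ℂ) + Complex.I * l * p.2)) (Icc 0 1 ×ˢ Icc (-1) 1) := by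
    refine hH.comp (by fun_prop) ?_
    intro p hp
    exact hmem p.1 p.2 hp.1.1
  obtain ⟨M, hM⟩ := (isCompact_Icc.prod isCompact_Icc).exists_bound_of_continuousOn hjoint
  have L1 : Tendsto (fun δ : ℝ => ∫ u in (-1:ℝ)..1, ((1 - |u| : ℝ) : ℂ) * Complex.exp (Complex.I * l * y * u) * H (1 + δ + Complex.I * l * u))
      (𝓝[>] 0) (𝓝 (∫ u in (-1:ℝ)..1, ((1 - |u| : ℝ) : ℂ) * Complex.exp (Complex.I * l * y * u) * H (1 + Complex.I * l * u))) := by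
    apply intervalIntegral.tendsto_integral_filter_of_dominated_convergence (fun _ => M)
    · filter_upwards [self_mem_nhdsWithin] with δ hδ
      have hδ' : (0:ℝ) < δ := hδ
      apply Continuous.aestronglyMeasurable
      refine Continuous.mul (by fun_prop) ?_
      exact hH.comp_continuous (by fun_prop) (fun u => hmem δ u hδ'.le)
    · have : Iic (1:ℝ) ∈ 𝓝[>] (0:ℝ) := mem_nhdsWithin_of_mem_nhds (Iic_mem_nhds (by norm_num))
      filter_upwards [self_mem_nhdsWithin, this] with δ hδ hδ1
      refine Eventually.of_forall fun u hu => ?_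
      have hδ' : (0:ℝ) < δ := hδ
      rw [uIoc_of_le (by norm_num)] at hu
      have hu' : |u| ≤ 1 := abs_le.mpr ⟨hu.1.le, hu.2⟩
      have a1 : (Complex.I * l * y * u).re = 0 := by simp
      simp only [norm_mul, Complex.norm_exp, Complex.norm_real, Real.norm_eq_abs]
      rw [a1, Real.exp_zero, mul_one, abs_of_nonneg (by linarith : 0 ≤ 1 - |u|)]
      have hb := hM (δ, u) ⟨⟨hδ'.le, hδ1⟩, ⟨hu.1.le, hu.2⟩⟩
      simp only at hb
      calc (1 - |u|) * ‖H (1 + δ + Complex.I * l * u)‖ ≤ 1 * ‖H (1 + δ + Complex.I * l * u)‖ := by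
            gcongr; linarith [abs_nonneg u]
        _ ≤ M := by rw [one_mul]; exact hb
    · exact intervalIntegrable_const
    · refine Eventually.of_forall fun u hu => ?_
      refine Tendsto.const_mul _ ?_
      have hc : ContinuousWithinAt H {s | 1 ≤ s.re} (1 + Complex.I * l * u) := hH _ (hmem0 u)
      refine hc.tendsto.comp ?_
      refine tendsto_nhdsWithin_iff.mpr ⟨?_, ?_⟩
      · apply tendsto_nhdsWithin_of_tendsto_nhds
        have : Continuous fun δ : ℝ => (1 + (δ:ℂ) + Complex.I * l * u) := by fun_prop
        simpa using this.tendsto 0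
      · filter_upwards [self_mem_nhdsWithin] with δ hδ
        have hδ' : (0:ℝ) < δ := hδ
        exact hmem δ u hδ'.le
  have L2 : Tendsto (fun δ : ℝ => ∫ v in Ioi (0:ℝ), ((pntF v * Real.exp (-δ * v) * fejer (l * (v - y)) : ℝ) : ℂ))
      (𝓝[>] 0) (𝓝 (∫ v in Ioi (0:ℝ), ((pntF v * fejer (l * (v - y)) : ℝ) : ℂ))) := by
    apply tendsto_integral_filter_of_dominated_convergence (fun v => (Real.log 4 + 5) * fejer (l * (v - y)))
    · refine Eventually.of_forall fun δ => ?_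
      apply Measurable.aestronglyMeasurable
      have := pntF_meas
      have := fejer_meas
      fun_prop
    · filter_upwards [self_mem_nhdsWithin] with δ hδ
      have hδ' : (0:ℝ) < δ := hδ
      filter_upwards [ae_restrict_mem measurableSet_Ioi] with v hv
      have hv' : (0:ℝ) < v := hv
      rw [Complex.norm_real, Real.norm_eq_abs, abs_mul, abs_mul, Real.abs_exp, abs_of_nonneg (fejer_nonneg _)]
      have h1 : Real.exp (-δ * v) ≤ 1 := by
        rw [Real.exp_le_one_iff]; nlinarith
      have h2 := pntF_bound (v := v)
      have h3 := fejer_nonneg (l * (v - y))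
      have h4 : |pntF v| * Real.exp (-δ * v) ≤ Real.log 4 + 5 := by
        calc _ ≤ |pntF v| * 1 := by gcongr
          _ ≤ _ := by linarith
      gcongr
    · exact ((fejer_shift_integrable hl y).const_mul _).integrableOn
    · refine Eventually.of_forall fun v => ?_
      have : Continuous fun δ : ℝ => ((pntF v * Real.exp (-δ * v) * fejer (l * (v - y)) : ℝ) : ℂ) := by fun_prop
      have h := this.tendsto 0
      simp only [neg_zero, zero_mul, Real.exp_zero, mul_one] at h
      exact tendsto_nhdsWithin_of_tendsto_nhds h
  refine tendsto_nhds_unique L1 (L2.congr' ?_)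
  filter_upwards [self_mem_nhdsWithin] with δ hδ
  exact (pnt_fubini hHe hl hδ y).symm

lemma pnt_smooth {l : ℝ} (hl : 0 < l) :
    Tendsto (fun y : ℝ => ∫ v in Ioi (0:ℝ), pntF v * fejer (l * (v - y))) atTop (𝓝 0) := by
  obtain ⟨H, hH, hHe⟩ := pnt_H
  set g : ℝ → ℂ := (Ioc (-1:ℝ) 1).indicator fun u => ((1 - |u| : ℝ) : ℂ) * H (1 + Complex.I * l * u) with hg
  have RL := Real.tendsto_integral_exp_smul_cocompact g
  have ht : Tendsto (fun y : ℝ => -(l / (2 * Real.pi)) * y) atTop (cocompact ℝ) := by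
    refine (Tendsto.const_mul_atTop_of_neg ?_ tendsto_id).mono_right atBot_le_cocompact
    have := Real.pi_pos
    have : 0 < l / (2 * Real.pi) := by positivity
    linarith
  have h2 := RL.comp ht
  have h3 : ∀ y : ℝ, ((∫ v in Ioi (0:ℝ), pntF v * fejer (l * (v - y)) : ℝ) : ℂ) =
      ∫ v : ℝ, Real.fourierChar (-(v * (-(l / (2 * Real.pi)) * y))) • g v := by
    intro y
    rw [← integral_complex_ofReal]
    rw [← pnt_limit hH hHe hl y, intervalIntegral.integral_of_le (by norm_num), ← integral_indicator measurableSet_Ioc]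
    congr 1
    ext u
    rw [hg]
    by_cases hu : u ∈ Ioc (-1:ℝ) 1
    · simp only [indicator_of_mem hu, Circle.smul_def, Real.fourierChar_apply, smul_eq_mul]
      have : Complex.exp (((2 * Real.pi * -(u * (-(l / (2 * Real.pi)) * y)) : ℝ) : ℂ) * Complex.I) = Complex.exp (Complex.I * l * y * u) := by
        congr 1
        have h : 2 * Real.pi * -(u * (-(l / (2 * Real.pi)) * y)) = l * y * u := by
          have := Real.pi_ne_zero
          field_simp
        rw [h]; push_cast; ring
      rw [this]; ring
    · simp [indicator_of_notMem hu]
  have h4 : Tendsto (fun y : ℝ => ((∫ v in Ioi (0:ℝ), pntF v * fejer (l * (v - y)) : ℝ) : ℂ)) atTop (𝓝 ((0:ℝ):ℂ)) := by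
    simp_rw [h3, Complex.ofReal_zero]
    exact h2
  exact (Complex.continuous_re.tendsto _).comp h4

lemma fejer_integral_pos : 0 < ∫ r, fejer r := by
  rw [integral_pos_iff_support_of_nonneg fejer_nonneg fejer_integrable]
  have hsub : Ioo (1:ℝ) 2 ⊆ Function.support fejer := by
    intro r hr
    have h1 : Real.cos r < 1 := by
      have := Real.cos_lt_cos_of_nonneg_of_le_pi (x := 0) (y := r) le_rfl (by linarith [hr.2, Real.pi_gt_three]) (by linarith [hr.1])
      simpa using this
    have h2 : 0 < r := by linarith [hr.1]
    have : 0 < fejer r := by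
      unfold fejer
      apply div_pos <;> [linarith; positivity]
    exact this.ne'
  refine lt_of_lt_of_le ?_ (measure_mono hsub)
  simp

lemma psi_upper {ε : ℝ} (hε : 0 < ε) : ∀ᶠ x : ℝ in atTop, Chebyshev.psi x ≤ (1 + ε) * x := by
  set I := ∫ r, fejer r with hI
  have hIpos : 0 < I := fejer_integral_pos
  set e := min 1 ε / 3 with he
  have he0 : 0 < e := by rw [he]; have := lt_min one_pos hε; positivity
  have he1 : 3 * e ≤ 1 := by rw [he]; linarith [min_le_left 1 ε]
  have he2 : 3 * e ≤ ε := by rw [he]; linarith [min_le_right 1 ε]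
  have hT : Tendsto (fun T : ℝ => ∫ r in (-T)..T, fejer r) atTop (𝓝 I) :=
    intervalIntegral_tendsto_integral fejer_integrable tendsto_neg_atTop_atBot tendsto_id
  have hlt : I / (1 + e) < I := by
    rw [div_lt_iff₀ (by linarith)]; nlinarith
  obtain ⟨T, hTJ, hT0⟩ := ((hT.eventually (lt_mem_nhds hlt)).and (eventually_gt_atTop 0)).exists
  set J := ∫ r in (-T)..T, fejer r with hJ
  have hIJ : I < (1 + e) * J := by
    rw [div_lt_iff₀ (by linarith)] at hTJ; linarith
  have hJpos : 0 < J := by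
    by_contra h
    push Not at h
    nlinarith
  set η := Real.log (1 + e) / 2 with hη
  have hη0 : 0 < η := by
    have := Real.log_pos (by linarith : 1 < 1 + e)
    positivity
  have hexp : Real.exp (2 * η) = 1 + e := by
    rw [hη, mul_div_cancel₀ _ (by norm_num), Real.exp_log (by linarith)]
  set l := T / η with hl
  have hl0 : 0 < l := by positivity
  have hlη : l * η = T := by rw [hl]; field_simp
  have hsm := pnt_smooth hl0
  have hsm2 : Tendsto (fun y : ℝ => ∫ v in Ioi (0:ℝ), pntF v * fejer (l * (v - (y + η)))) atTop (𝓝 0) :=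
    hsm.comp (tendsto_atTop_add_const_right _ _ tendsto_id)
  have hpos : 0 < ((1 + e) * J - I) / l := by
    apply div_pos <;> linarith
  have hev := hsm2.eventually (gt_mem_nhds hpos)
  have hmain : ∀ᶠ y : ℝ in atTop, Chebyshev.psi (Real.exp y) ≤ (1 + ε) * Real.exp y := by
    filter_upwards [hev, eventually_gt_atTop 0] with y hy hy0
    set K : ℝ → ℝ := fun v => fejer (l * (v - (y + η))) with hK
    have hKint : Integrable K := fejer_shift_integrable hl0 _
    have hKnn : ∀ v, 0 ≤ K v := fun v => fejer_nonneg _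
    have hKtot : ∫ v, K v = I / l := by
      rw [hK]
      rw [integral_sub_right_eq_self (fun v => fejer (l * v)) (y + η), Measure.integral_comp_mul_left fejer l, abs_of_pos (inv_pos.mpr hl0)]
      simp [hI]; ring
    have hKwin : ∫ v in y..(y + 2 * η), K v = J / l := by
      rw [hK]
      rw [intervalIntegral.integral_comp_sub_right (fun v => fejer (l * v)) (y + η), intervalIntegral.integral_comp_mul_left fejer hl0.ne']
      have a1 : l * (y - (y + η)) = -T := by rw [← hlη]; ring
      have a2 : l * (y + 2 * η - (y + η)) = T := by rw [← hlη]; ring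
      rw [a1, a2, smul_eq_mul, ← hJ]; ring
    have hfK : Integrable (fun v => pntF v * K v) (volume.restrict (Ioi 0)) := by
      refine Integrable.bdd_mul (c := Real.log 4 + 5) hKint.integrableOn pntF_meas.aestronglyMeasurable ?_
      exact Eventually.of_forall fun v => by simpa using pntF_bound
    have hsum : Integrable (fun v => (pntF v + 1) * K v) (volume.restrict (Ioi 0)) := by
      simp only [add_mul, one_mul]
      exact hfK.add hKint.integrableOn
    have e1 : ∫ v in Ioi (0:ℝ), (pntF v + 1) * K v = (∫ v in Ioi (0:ℝ), pntF v * K v) + ∫ v in Ioi (0:ℝ), K v := by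
      rw [← integral_add hfK hKint.integrableOn]
      simp only [add_mul, one_mul]
    have e2 : ∫ v in Ioi (0:ℝ), K v ≤ I / l := by
      rw [← hKtot]
      exact setIntegral_le_integral hKint (Eventually.of_forall hKnn)
    have hB : ∀ v, 0 ≤ pntF v + 1 := by
      intro v
      unfold pntF
      have := Chebyshev.psi_nonneg (Real.exp v)
      have : 0 ≤ Chebyshev.psi (Real.exp v) * Real.exp (-v) := by positivity
      linarith
    have e3 : ∫ v in Ioc y (y + 2 * η), (pntF v + 1) * K v ≤ ∫ v in Ioi (0:ℝ), (pntF v + 1) * K v := by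
      apply setIntegral_mono_set hsum
      · exact Eventually.of_forall fun v => mul_nonneg (hB v) (hKnn v)
      · apply LE.le.eventuallyLE
        intro v hv
        exact lt_trans hy0 hv.1
    set B := Chebyshev.psi (Real.exp y) * Real.exp (-y) * Real.exp (-(2 * η)) with hBdef
    have e4 : B * (J / l) ≤ ∫ v in Ioc y (y + 2 * η), (pntF v + 1) * K v := by
      rw [← hKwin, intervalIntegral.integral_of_le (by linarith), ← integral_const_mul]
      apply setIntegral_mono_on
      · exact (hKint.const_mul _).integrableOn
      · apply IntegrableOn.mono_set hsum
        intro v hv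
        exact lt_trans hy0 hv.1
      · exact measurableSet_Ioc
      · intro v hv
        apply mul_le_mul_of_nonneg_right _ (hKnn v)
        unfold pntF
        rw [hBdef, mul_assoc, ← Real.exp_add, sub_add_cancel]
        apply mul_le_mul
        · exact Chebyshev.psi_mono (Real.exp_le_exp.mpr hv.1.le)
        · apply Real.exp_le_exp.mpr; linarith [hv.2]
        · positivity
        · exact Chebyshev.psi_nonneg _
    have e5 : B * (J / l) < (1 + e) * (J / l) := by
      calc B * (J / l) ≤ _ := e4.trans e3
        _ = _ := e1
        _ < ((1 + e) * J - I) / l + I / l := by linarith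
        _ = _ := by ring
    have e6 : B < 1 + e := lt_of_mul_lt_mul_right e5 (by positivity)
    have e7 : Chebyshev.psi (Real.exp y) = B * Real.exp (2 * η) * Real.exp y := by
      rw [hBdef]
      rw [mul_assoc (Chebyshev.psi _), ← Real.exp_add, mul_assoc, mul_assoc, ← Real.exp_add, ← Real.exp_add]
      ring_nf
      simp
    rw [e7, hexp]
    have : B * (1 + e) ≤ 1 + ε := by nlinarith
    exact mul_le_mul_of_nonneg_right this (Real.exp_pos y).le
  filter_upwards [Real.tendsto_log_atTop.eventually hmain, eventually_gt_atTop 0] with x hx hx0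
  rwa [Real.exp_log hx0] at hx

lemma pi_upper {ε : ℝ} (hε : 0 < ε) :
    ∀ᶠ x : ℝ in atTop, (Nat.primeCounting ⌊x⌋₊ : ℝ) ≤ (1 + ε) * (x / Real.log x) := by
  have h1 := psi_upper (half_pos hε)
  obtain ⟨C, hC⟩ := Chebyshev.primeCounting_sub_theta_div_log_isBigO.bound
  have h2 : ∀ᶠ x : ℝ in atTop, 2 * |C| / ε < Real.log x := Real.tendsto_log_atTop.eventually_gt_atTop _
  filter_upwards [h1, hC, h2, eventually_gt_atTop 1] with x hx hx2 hx3 hx1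
  have hlog : 0 < Real.log x := Real.log_pos hx1
  have hle : Chebyshev.theta x / Real.log x ≤ (1 + ε / 2) * (x / Real.log x) := by
    rw [← mul_div_assoc]
    exact div_le_div_of_nonneg_right ((Chebyshev.theta_le_psi x).trans hx) hlog.le
  have h4 : ‖x / Real.log x ^ 2‖ = x / Real.log x ^ 2 := Real.norm_of_nonneg (by positivity)
  rw [h4] at hx2
  have h5 := (le_abs_self _).trans hx2
  have h6 : C * (x / Real.log x ^ 2) ≤ ε / 2 * (x / Real.log x) := by
    have : C * (x / Real.log x ^ 2) = (C / Real.log x) * (x / Real.log x) := by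
      field_simp
    rw [this]
    apply mul_le_mul_of_nonneg_right _ (by positivity)
    rw [div_le_iff₀ hlog]
    rw [div_lt_iff₀ hε] at hx3
    linarith [le_abs_self C]
  linarith

end PNT

section NT

lemma sigma1_mul {m n : ℕ} (h : Nat.Coprime m n) : sigma1 (m * n) = sigma1 m * sigma1 n := by
  unfold sigma1
  exact ArithmeticFunction.isMultiplicative_sigma.map_mul_of_coprime h

lemma sigma1_pos {n : ℕ} (h : 0 < n) : 0 < sigma1 n :=
  ArithmeticFunction.sigma_pos 1 n h.ne'

lemma le_sigma1 {n : ℕ} (h : 0 < n) : n ≤ sigma1 n := by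
  unfold sigma1
  rw [ArithmeticFunction.sigma_one_apply]
  exact Finset.single_le_sum (f := fun d => d) (fun _ _ => Nat.zero_le _) (Nat.mem_divisors_self n h.ne')

lemma sigma1_prime {p : ℕ} (hp : p.Prime) : sigma1 p = p + 1 := by
  unfold sigma1
  have := ArithmeticFunction.sigma_one_apply_prime_pow (i := 1) hp
  simp [Finset.sum_range_succ] at this
  omega

lemma coprime_sigma1_prime_pow {p : ℕ} (hp : p.Prime) (e : ℕ) : Nat.Coprime (p ^ e) (sigma1 (p ^ e)) := by
  apply Nat.Coprime.pow_left
  unfold sigma1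
  rw [ArithmeticFunction.sigma_one_apply_prime_pow hp, Finset.sum_range_succ', pow_zero]
  rw [Nat.Prime.coprime_iff_not_dvd hp]
  intro h
  have h2 : p ∣ ∑ k ∈ Finset.range e, p ^ (k + 1) :=
    Finset.dvd_sum fun k _ => dvd_pow_self p (Nat.succ_ne_zero k)
  have h3 := (Nat.dvd_add_right h2).mp h
  exact hp.one_lt.ne' (Nat.dvd_one.mp h3)

lemma sigma1_le {n : ℕ} (h : 0 < n) : (sigma1 n : ℝ) ≤ n * (1 + Real.log n) := by
  unfold sigma1
  rw [ArithmeticFunction.sigma_eq_sum_div]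
  have h1 : ((∑ d ∈ n.divisors, (n / d) ^ 1 : ℕ) : ℝ) ≤ ∑ d ∈ Finset.Icc 1 n, (n : ℝ) * ((d : ℝ))⁻¹ := by
    push_cast
    have : n.divisors ⊆ Finset.Icc 1 n := by
      intro d hd
      rw [Finset.mem_Icc]
      exact ⟨Nat.pos_of_mem_divisors hd, Nat.divisor_le hd⟩
    refine le_trans (Finset.sum_le_sum (g := fun d : ℕ => (n : ℝ) * ((d : ℝ))⁻¹) ?_) (Finset.sum_le_sum_of_subset_of_nonneg this ?_)
    · intro d _
      rw [pow_one, ← div_eq_mul_inv]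
      exact Nat.cast_div_le
    · intros; positivity
  refine h1.trans ?_
  rw [← Finset.mul_sum]
  gcongr
  have := harmonic_le_one_add_log n
  rw [harmonic_eq_sum_Icc] at this
  push_cast at this
  exact this

lemma sum_tau_le (N : ℕ) : ((∑ n ∈ Finset.Ioc 0 N, n.divisors.card : ℕ) : ℝ) ≤ N * (1 + Real.log N) := by
  have h := ArithmeticFunction.sum_Ioc_sigma0_eq_sum_div N
  simp only [ArithmeticFunction.sigma_zero_apply] at h
  rw [h]
  push_cast
  have : ∑ n ∈ Finset.Ioc 0 N, ((N / n : ℕ) : ℝ) ≤ ∑ d ∈ Finset.Icc 1 N, (N : ℝ) * ((d : ℝ))⁻¹ := by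
    have : Finset.Ioc 0 N = Finset.Icc 1 N := rfl
    rw [this]
    apply Finset.sum_le_sum
    intro d _
    rw [← div_eq_mul_inv]
    exact Nat.cast_div_le
  refine this.trans ?_
  rw [← Finset.mul_sum]
  gcongr
  have := harmonic_le_one_add_log N
  rw [harmonic_eq_sum_Icc] at this
  push_cast at this
  exact this

lemma two_pow_omega_le {n : ℕ} (h : n ≠ 0) : 2 ^ n.primeFactors.card ≤ n.divisors.card := by
  rw [Nat.card_divisors h]
  apply Finset.pow_card_le_prod
  intro p hp
  have := (Nat.prime_of_mem_primeFactors hp).factorization_pos_of_dvd h (Nat.dvd_of_mem_primeFactors hp)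
  omega

/-- all prime power components bounded by `z` -/
lemma le_pow_omega {n : ℕ} (h : n ≠ 0) {z : ℝ} (hz : ∀ p ∈ n.primeFactors, ((p ^ n.factorization p : ℕ) : ℝ) ≤ z) :
    (n : ℝ) ≤ z ^ n.primeFactors.card := by
  have h1 : n = ∏ p ∈ n.primeFactors, p ^ n.factorization p := (Nat.prod_factorization_pow_eq_self h).symm
  have h2 : (n : ℝ) = ∏ p ∈ n.primeFactors, ((p ^ n.factorization p : ℕ) : ℝ) := by
    conv_lhs => rw [h1]
    push_cast
    rfl
  rw [h2]
  calc ∏ p ∈ n.primeFactors, ((p ^ n.factorization p : ℕ) : ℝ) ≤ ∏ p ∈ n.primeFactors, z :=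
        Finset.prod_le_prod (fun _ _ => Nat.cast_nonneg _) hz
    _ = z ^ n.primeFactors.card := by rw [Finset.prod_const]

/-- perfect numbers with a large component -/
lemma perfect_large (a b : ℕ) (ha : 0 < a) (hb : 0 < b) (N : ℕ) {z : ℝ} (hz : 0 < z) (S : Finset ℕ)
    (hS : ∀ n ∈ S, 1 ≤ n ∧ n ≤ N ∧ b * sigma1 n = a * n ∧
      ∃ p ∈ n.primeFactors, z < ((p ^ n.factorization p : ℕ) : ℝ)) :
    (S.card : ℝ) ≤ N / z := by
  choose! hS1 hSN hSp p hpp hpz using hS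
  have hq : ∀ n ∈ S, n = p n ^ n.factorization (p n) * (n / p n ^ n.factorization (p n)) := by
    intro n hn
    exact (Nat.ordProj_mul_ordCompl_eq_self n (p n)).symm
  have hprime : ∀ n ∈ S, (p n).Prime := fun n hn => Nat.prime_of_mem_primeFactors (hpp n hn)
  have hcop : ∀ n ∈ S, Nat.Coprime (p n ^ n.factorization (p n)) (n / p n ^ n.factorization (p n)) := by
    intro n hn
    exact Nat.Coprime.pow_left _ (Nat.coprime_ordCompl (hprime n hn) (by have := hS1 n hn; omega))
  have hmaps : ∀ n ∈ S, n / p n ^ n.factorization (p n) ∈ Finset.Icc 1 ⌊(N : ℝ) / z⌋₊ := by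
    intro n hn
    have h1 := hq n hn
    have hn1 := hS1 n hn
    set q := p n ^ n.factorization (p n)
    set m := n / q
    rw [Finset.mem_Icc]
    constructor
    · rcases Nat.eq_zero_or_pos m with h0 | h0
      · rw [h0] at h1; omega
      · exact h0
    · apply Nat.le_floor
      rw [le_div_iff₀ hz]
      have h2 : ((q * m : ℕ) : ℝ) ≤ N := by
        rw [← h1]; exact_mod_cast hSN n hn
      push_cast at h2
      nlinarith [hpz n hn, (Nat.cast_nonneg m : (0:ℝ) ≤ m)]
  have hinj : Set.InjOn (fun n => n / p n ^ n.factorization (p n)) S := by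
    intro n hn n' hn' heq
    have hn := Finset.mem_coe.mp hn
    have hn' := Finset.mem_coe.mp hn'
    simp only at heq
    have h1 := hq n hn
    have h1' := hq n' hn'
    have c1 := hcop n hn
    have c1' := hcop n' hn'
    have s1 := coprime_sigma1_prime_pow (hprime n hn) (n.factorization (p n))
    have s1' := coprime_sigma1_prime_pow (hprime n' hn') (n'.factorization (p n'))
    have m1 := (Finset.mem_Icc.mp (hmaps n hn)).1
    have e1 := hSp n hn
    have e1' := hSp n' hn'
    have pos := hS1 n hn
    have pos' := hS1 n' hn'
    rw [← heq] at h1' c1'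
    set q := p n ^ n.factorization (p n)
    set q' := p n' ^ n'.factorization (p n')
    set m := n / q
    rw [h1, sigma1_mul c1] at e1
    rw [h1', sigma1_mul c1'] at e1'
    have hmpos : 0 < sigma1 m := sigma1_pos m1
    have key : sigma1 q * q' = sigma1 q' * q := by
      have hc : 0 < b * sigma1 m * (a * m) := by positivity
      apply Nat.eq_of_mul_eq_mul_left hc
      calc b * sigma1 m * (a * m) * (sigma1 q * q') = (b * (sigma1 q * sigma1 m)) * (a * (q' * m)) := by ring
        _ = (a * (q * m)) * (b * (sigma1 q' * sigma1 m)) := by rw [e1, e1']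
        _ = _ := by ring
    have d1 : q ∣ q' := s1.dvd_of_dvd_mul_left (Dvd.intro_left (sigma1 q') key.symm)
    have d2 : q' ∣ q := s1'.dvd_of_dvd_mul_left (Dvd.intro_left (sigma1 q) key)
    rw [h1, h1', Nat.dvd_antisymm d1 d2]
  have := Finset.card_le_card_of_injOn _ hmaps hinj
  rw [Nat.card_Icc, Nat.add_sub_cancel] at this
  calc (S.card : ℝ) ≤ (⌊(N : ℝ) / z⌋₊ : ℝ) := by exact_mod_cast this
    _ ≤ N / z := Nat.floor_le (by positivity)

lemma perfect_count (a b : ℕ) (ha : 0 < a) (hb : 0 < b) (N : ℕ) (hN : 2 ≤ N) (S : Finset ℕ)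
    (hS : ∀ n ∈ S, 1 ≤ n ∧ n ≤ N ∧ b * sigma1 n = a * n) :
    (S.card : ℝ) ≤ Real.sqrt N + N / Real.exp (Real.sqrt (Real.log N)) +
      N * (1 + Real.log N) / 2 ^ (Real.sqrt (Real.log N) / 2) := by
  classical
  set L := Real.sqrt (Real.log N) with hL
  have hN0 : (0:ℝ) < N := by positivity
  have hlog : 0 < Real.log N := Real.log_pos (by exact_mod_cast hN)
  have hL0 : 0 < L := Real.sqrt_pos.mpr hlog
  have hL2 : L ^ 2 = Real.log N := Real.sq_sqrt hlog.le
  set A := S.filter (fun n : ℕ => (n : ℝ) ≤ Real.sqrt N) with hA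
  set B := S.filter (fun n : ℕ => ∃ p ∈ n.primeFactors, Real.exp L < ((p ^ n.factorization p : ℕ) : ℝ)) with hB
  set C := S.filter (fun n : ℕ => ¬ ((n : ℝ) ≤ Real.sqrt N) ∧
    ¬ ∃ p ∈ n.primeFactors, Real.exp L < ((p ^ n.factorization p : ℕ) : ℝ)) with hC
  have hsub : S ⊆ A ∪ B ∪ C := by
    intro n hn
    simp only [hA, hB, hC, Finset.mem_union, Finset.mem_filter]
    by_cases h1 : (n : ℝ) ≤ Real.sqrt N
    · exact Or.inl (Or.inl ⟨hn, h1⟩)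
    · by_cases h2 : ∃ p ∈ n.primeFactors, Real.exp L < ((p ^ n.factorization p : ℕ) : ℝ)
      · exact Or.inl (Or.inr ⟨hn, h2⟩)
      · exact Or.inr ⟨hn, h1, h2⟩
  have hcard : (S.card : ℝ) ≤ A.card + B.card + C.card := by
    have h1 := Finset.card_le_card hsub
    have h2 := Finset.card_union_le (A ∪ B) C
    have h3 := Finset.card_union_le A B
    exact_mod_cast (by omega : S.card ≤ A.card + B.card + C.card)
  have hAc : (A.card : ℝ) ≤ Real.sqrt N := by
    have : A ⊆ Finset.Icc 1 ⌊Real.sqrt N⌋₊ := by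
      intro n hn
      rw [hA, Finset.mem_filter] at hn
      rw [Finset.mem_Icc]
      exact ⟨(hS n hn.1).1, Nat.le_floor hn.2⟩
    have h := Finset.card_le_card this
    rw [Nat.card_Icc, Nat.add_sub_cancel] at h
    calc (A.card : ℝ) ≤ (⌊Real.sqrt N⌋₊ : ℝ) := by exact_mod_cast h
      _ ≤ _ := Nat.floor_le (Real.sqrt_nonneg _)
  have hBc : (B.card : ℝ) ≤ N / Real.exp L := by
    apply perfect_large a b ha hb N (Real.exp_pos L) B
    intro n hn
    rw [hB, Finset.mem_filter] at hn
    obtain ⟨h1, h2, h3⟩ := hS n hn.1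
    exact ⟨h1, h2, h3, hn.2⟩
  have hCc : (C.card : ℝ) ≤ N * (1 + Real.log N) / 2 ^ (L / 2) := by
    have hp : (0:ℝ) < 2 ^ (L / 2) := by positivity
    rw [le_div_iff₀ hp]
    have h1 : ∀ n ∈ C, (2:ℝ) ^ (L / 2) ≤ (n.divisors.card : ℝ) := by
      intro n hn
      rw [hC, Finset.mem_filter] at hn
      obtain ⟨hnS, hn1, hn2⟩ := hn
      push Not at hn1 hn2
      obtain ⟨h1, h2, h3⟩ := hS n hnS
      have hn0 : n ≠ 0 := by omega
      have h4 := le_pow_omega hn0 hn2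
      have h5 := lt_of_lt_of_le hn1 h4
      rw [← Real.exp_nat_mul] at h5
      have h6 : Real.sqrt N = Real.exp (L ^ 2 / 2) := by
        rw [hL2, Real.sqrt_eq_rpow, Real.rpow_def_of_pos hN0]; ring_nf
      rw [h6, Real.exp_lt_exp] at h5
      have h7 : L / 2 < n.primeFactors.card := by nlinarith
      calc (2:ℝ) ^ (L / 2) ≤ 2 ^ (n.primeFactors.card : ℝ) :=
            Real.rpow_le_rpow_of_exponent_le (by norm_num) h7.le
        _ = ((2 ^ n.primeFactors.card : ℕ) : ℝ) := by rw [Real.rpow_natCast]; push_cast; rfl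
        _ ≤ _ := by exact_mod_cast two_pow_omega_le hn0
    calc (C.card : ℝ) * 2 ^ (L / 2) = ∑ n ∈ C, (2:ℝ) ^ (L / 2) := by rw [Finset.sum_const, nsmul_eq_mul]
      _ ≤ ∑ n ∈ C, (n.divisors.card : ℝ) := Finset.sum_le_sum h1
      _ ≤ ∑ n ∈ Finset.Ioc 0 N, (n.divisors.card : ℝ) := by
          apply Finset.sum_le_sum_of_subset_of_nonneg
          · intro n hn
            rw [hC, Finset.mem_filter] at hn
            obtain ⟨h1, h2, h3⟩ := hS n hn.1
            rw [Finset.mem_Ioc]; omega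
          · intros; positivity
      _ ≤ _ := by
          have := sum_tau_le N
          push_cast at this
          exact this
  linarith

lemma aux_exp_growth : ∀ᶠ y : ℝ in Filter.atTop, 2 ≤ y ∧ y ^ 4 ≤ Real.exp y ∧ (1 + y ^ 2) * y ^ 4 ≤ (2:ℝ) ^ (y / 2) := by
  have h1 := (isLittleO_pow_exp_pos_mul_atTop (k := 4) (b := 1) one_pos).bound one_pos
  have hlog : 0 < Real.log 2 / 2 := by have := Real.log_pos (by norm_num : (1:ℝ) < 2); positivity
  have h2 := (isLittleO_pow_exp_pos_mul_atTop (k := 7) (b := Real.log 2 / 2) hlog).bound one_pos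
  filter_upwards [h1, h2, Filter.eventually_ge_atTop (2:ℝ)] with y h1 h2 hy
  refine ⟨hy, ?_, ?_⟩
  · rw [one_mul, one_mul, Real.norm_of_nonneg (by positivity), Real.norm_of_nonneg (by positivity)] at h1
    exact h1
  · rw [one_mul, Real.norm_of_nonneg (by positivity), Real.norm_of_nonneg (by positivity)] at h2
    rw [Real.rpow_def_of_pos (by norm_num)]
    have : Real.log 2 * (y / 2) = Real.log 2 / 2 * y := by ring
    rw [this]
    refine le_trans ?_ h2
    have h3 : y ^ 7 = y ^ 3 * y ^ 4 := by ring
    rw [h3]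
    gcongr
    nlinarith

lemma perfect_count' (a b : ℕ) (ha : 0 < a) (hb : 0 < b) : ∀ᶠ N : ℕ in Filter.atTop, ∀ S : Finset ℕ,
    (∀ n ∈ S, 1 ≤ n ∧ n ≤ N ∧ b * sigma1 n = a * n) →
    (S.card : ℝ) ≤ 3 * N / (Real.log N) ^ 2 := by
  have ht : Filter.Tendsto (fun N : ℕ => Real.sqrt (Real.log N)) Filter.atTop Filter.atTop :=
    Real.tendsto_sqrt_atTop.comp (Real.tendsto_log_atTop.comp tendsto_natCast_atTop_atTop)
  filter_upwards [ht.eventually aux_exp_growth, Filter.eventually_ge_atTop 2] with N ⟨h2, h4, h6⟩ hN S hS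
  have h := perfect_count a b ha hb N hN S hS
  have hN0 : (0:ℝ) < N := by positivity
  have hlog : 0 < Real.log N := Real.log_pos (by exact_mod_cast hN)
  have hL2 : Real.sqrt (Real.log N) ^ 2 = Real.log N := Real.sq_sqrt hlog.le
  set L := Real.sqrt (Real.log N) with hL
  have hL0 : 0 < L := by linarith
  rw [← hL2] at h ⊢
  have h5 : Real.sqrt N = N / Real.exp (L ^ 2 / 2) := by
    have h6 : Real.sqrt N = Real.exp (L ^ 2 / 2) := by
      rw [hL2, Real.sqrt_eq_rpow, Real.rpow_def_of_pos hN0]; ring_nf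
    rw [eq_div_iff (Real.exp_pos _).ne', ← h6, Real.mul_self_sqrt hN0.le]
  have e1 : Real.sqrt N ≤ N / L ^ 4 := by
    rw [h5]
    gcongr
    refine h4.trans (Real.exp_le_exp.mpr ?_)
    nlinarith
  have e2 : N / Real.exp L ≤ N / L ^ 4 := by gcongr
  have e3 : N * (1 + L ^ 2) / 2 ^ (L / 2) ≤ N / L ^ 4 := by
    rw [div_le_div_iff₀ (by positivity) (by positivity), mul_assoc]
    gcongr
  have e4 : 3 * (N:ℝ) / (L ^ 2) ^ 2 = N / L ^ 4 + N / L ^ 4 + N / L ^ 4 := by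
    rw [← pow_mul]; ring
  rw [e4]
  linarith

/-- Wirsing-type summability -/
lemma perfect_summable (a b : ℕ) (ha : 0 < a) (hb : 0 < b) :
    Summable (fun m : {m : ℕ // 0 < m ∧ b * sigma1 m = a * m} => 1 / ((m : ℕ) : ℝ)) := by
  classical
  obtain ⟨N0, hN0⟩ := Filter.eventually_atTop.mp (perfect_count' a b ha hb)
  -- indicator function
  set f : ℕ → ℝ := fun m => if 0 < m ∧ b * sigma1 m = a * m then 1 / (m : ℝ) else 0 with hf
  have hf0 : ∀ m, 0 ≤ f m := by
    intro m; simp only [hf]; split_ifs <;> positivity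
  have hsum : Summable f := by
    -- block sums
    have hlog2 : 0 < Real.log 2 := Real.log_pos (by norm_num)
    set K := 6 / (Real.log 2) ^ 2 with hK
    have hblock : ∀ j : ℕ, N0 ≤ 2 ^ (j+1) → ∑ m ∈ Finset.Ico (2 ^ j) (2 ^ (j+1)), f m ≤ K * (1 / ((j + 1 : ℕ) : ℝ) ^ 2) := by
      intro j hj
      have h1 : ∑ m ∈ Finset.Ico (2 ^ j) (2 ^ (j+1)), f m ≤
          ∑ m ∈ (Finset.Ico (2 ^ j) (2 ^ (j+1))).filter (fun m => 0 < m ∧ b * sigma1 m = a * m), (1 / (2:ℝ) ^ j) := by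
        rw [Finset.sum_filter]
        apply Finset.sum_le_sum
        intro m hm
        rw [Finset.mem_Ico] at hm
        simp only [hf]
        split_ifs
        · gcongr
          exact_mod_cast hm.1
        · exact le_rfl
      refine h1.trans ?_
      rw [Finset.sum_const, nsmul_eq_mul]
      have h2 := hN0 (2 ^ (j+1)) hj ((Finset.Ico (2 ^ j) (2 ^ (j+1))).filter (fun m => 0 < m ∧ b * sigma1 m = a * m)) (by
        intro n hn
        rw [Finset.mem_filter, Finset.mem_Ico] at hn
        exact ⟨hn.2.1, hn.1.2.le, hn.2.2⟩)
      refine (mul_le_mul_of_nonneg_right h2 (by positivity)).trans (le_of_eq ?_)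
      push_cast
      rw [Real.log_pow, hK]
      push_cast
      have : (j:ℝ) + 1 ≠ 0 := by positivity
      field_simp
      ring
    have hs2 : Summable (fun j : ℕ => K * (1 / ((j + 1 : ℕ) : ℝ) ^ 2)) := by
      apply Summable.mul_left
      exact (summable_nat_add_iff 1).mpr (Real.summable_one_div_nat_pow.mpr (by norm_num : 1 < 2))
    set T := ∑' j : ℕ, K * (1 / ((j + 1 : ℕ) : ℝ) ^ 2) with hT
    set B := ∑ m ∈ Finset.range (2 ^ N0), f m with hB
    apply summable_of_sum_range_le (c := B + T) hf0
    intro n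
    have key : ∀ J : ℕ, ∑ m ∈ Finset.range (2 ^ (N0 + J)), f m ≤ B + ∑ j ∈ Finset.range J, K * (1 / ((N0 + j + 1 : ℕ) : ℝ) ^ 2) := by
      intro J
      induction J with
      | zero => simp [hB]
      | succ J ih =>
        rw [Finset.sum_range_succ (n := J)]
        have h1 := Finset.sum_range_add_sum_Ico f (Nat.pow_le_pow_right (by norm_num : 0 < 2) (Nat.le_succ (N0 + J)))
        have h2 := hblock (N0 + J) (by
          have : N0 + J + 1 < 2 ^ (N0 + J + 1) := Nat.lt_two_pow_self
          omega)
        have h3 : N0 + (J + 1) = (N0 + J).succ := rfl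
        rw [h3, ← h1]
        have h4 : (N0 + J).succ = N0 + J + 1 := rfl
        rw [h4]
        linarith
    have hn : n ≤ 2 ^ (N0 + n) := by
      have : N0 + n < 2 ^ (N0 + n) := Nat.lt_two_pow_self
      omega
    calc ∑ m ∈ Finset.range n, f m ≤ ∑ m ∈ Finset.range (2 ^ (N0 + n)), f m := by
          apply Finset.sum_le_sum_of_subset_of_nonneg
          · exact Finset.range_subset_range.mpr hn
          · intros; exact hf0 _
      _ ≤ B + ∑ j ∈ Finset.range n, K * (1 / ((N0 + j + 1 : ℕ) : ℝ) ^ 2) := key n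
      _ ≤ B + ∑ j ∈ Finset.range n, K * (1 / ((j + 1 : ℕ) : ℝ) ^ 2) := by
          gcongr with j hj
          omega
      _ ≤ B + T := by
          gcongr
          exact hs2.sum_le_tsum _ (fun j _ => by positivity)
  have := hsum.subtype {m : ℕ | 0 < m ∧ b * sigma1 m = a * m}
  refine this.congr ?_
  rintro ⟨m, hm⟩
  simp only [Function.comp, hf]
  exact if_pos hm

/-- for a fixed unitary divisor `m` -/
lemma caseB_fixed (a b m N D : ℕ) (hm : 1 ≤ m) (S : Finset ℕ)
    (hS : ∀ m' ∈ S, 1 ≤ m' ∧ m * m' ≤ N ∧ Nat.Coprime m m' ∧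
      ((b * sigma1 (m * m') : ℕ) : ℤ) - ((a * (m * m') : ℕ) : ℤ) ≠ 0 ∧
      |((b * sigma1 (m * m') : ℕ) : ℤ) - ((a * (m * m') : ℕ) : ℤ)| ≤ D) :
    (S.card : ℝ) ≤ 2 * D * (N * ((m:ℝ) ^ 2)⁻¹ + 1) := by
  classical
  set s := sigma1 m with hs
  have hs0 : 0 < s := sigma1_pos hm
  have hsm : m ≤ s := le_sigma1 hm
  set g := Nat.gcd (a * m) s with hg
  have hg0 : 0 < g := Nat.gcd_pos_of_pos_right _ hs0
  obtain ⟨s1, hs1⟩ : g ∣ s := Nat.gcd_dvd_right _ _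
  obtain ⟨t1, ht1⟩ : g ∣ a * m := Nat.gcd_dvd_left _ _
  have hs10 : 0 < s1 := by
    rcases Nat.eq_zero_or_pos s1 with h | h
    · rw [h] at hs1; omega
    · exact h
  have hcop : Nat.Coprime s1 t1 := by
    have h := Nat.coprime_div_gcd_div_gcd (m := a * m) (n := s) hg0
    rw [← hg] at h
    have e1 : a * m / g = t1 := by rw [ht1]; exact Nat.mul_div_cancel_left _ hg0
    have e2 : s / g = s1 := by rw [hs1]; exact Nat.mul_div_cancel_left _ hg0
    rw [e1, e2] at h
    exact h.symm
  set d : ℕ → ℤ := fun m' => (b * sigma1 m' : ℤ) * s1 - t1 * m' with hd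
  have hdeq : ∀ m' ∈ S, ((b * sigma1 (m * m') : ℕ) : ℤ) - ((a * (m * m') : ℕ) : ℤ) = g * d m' := by
    intro m' hm'
    rw [sigma1_mul (hS m' hm').2.2.1, ← hs, ← mul_assoc a, ht1, hs1]
    push_cast
    simp only [hd]
    ring
  set F : ℕ → ℤ × ℕ := fun m' => (d m', m' / s1) with hF
  have hmaps : ∀ m' ∈ S, F m' ∈ ((Finset.Icc (-((D / g : ℕ) : ℤ)) ((D / g : ℕ) : ℤ)).erase 0) ×ˢ Finset.range (N / m / s1 + 1) := by
    intro m' hm'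
    obtain ⟨h1, h2, h3, h4, h5⟩ := hS m' hm'
    rw [hdeq m' hm'] at h4 h5
    rw [Finset.mem_product]
    refine ⟨?_, ?_⟩
    · simp only [hF]
      rw [Finset.mem_erase, Finset.mem_Icc, ← abs_le]
      refine ⟨right_ne_zero_of_mul h4, ?_⟩
      push_cast
      rw [Int.le_ediv_iff_mul_le (by exact_mod_cast hg0)]
      rw [abs_mul, Nat.abs_cast] at h5
      linarith
    · simp only [hF]
      rw [Finset.mem_range, Nat.lt_succ_iff]
      apply Nat.div_le_div_right
      rw [Nat.le_div_iff_mul_le hm]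
      linarith
  have hinj : Set.InjOn F S := by
    intro m1 hm1 m2 hm2 heq
    simp only [hF, Prod.mk.injEq] at heq
    obtain ⟨h1, h2⟩ := heq
    simp only [hd] at h1
    have h3 : (s1 : ℤ) ∣ t1 * ((m1 : ℤ) - m2) := by
      refine ⟨b * sigma1 m1 - b * sigma1 m2, ?_⟩
      linarith
    have h4 : (s1 : ℤ) ∣ (m1 : ℤ) - m2 :=
      (Int.isCoprime_iff_gcd_eq_one.mpr (by simpa using hcop)).dvd_of_dvd_mul_left h3
    have h5 : m2 ≡ m1 [MOD s1] := (Nat.modEq_iff_dvd).mpr h4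
    have h6 : m2 % s1 = m1 % s1 := h5
    rw [← Nat.div_add_mod m1 s1, ← Nat.div_add_mod m2 s1, h2, h6]
  have hcard := Finset.card_le_card_of_injOn F hmaps hinj
  rw [Finset.card_product, Finset.card_range, Finset.card_erase_of_mem (by simp; positivity), Int.card_Icc] at hcard
  have hcard2 : S.card ≤ 2 * (D / g) * (N / m / s1 + 1) := by
    refine hcard.trans (Nat.mul_le_mul_right _ ?_)
    omega
  have hm0 : (0:ℝ) < m := by exact_mod_cast hm
  have hg0' : (0:ℝ) < g := by exact_mod_cast hg0
  have hs10' : (0:ℝ) < s1 := by exact_mod_cast hs10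
  have hg1 : (1:ℝ) ≤ g := by exact_mod_cast hg0
  have hsr : (m:ℝ) ≤ g * s1 := by
    have : m ≤ g * s1 := hs1 ▸ hsm
    exact_mod_cast this
  have e1 : ((D / g : ℕ) : ℝ) ≤ D / g := Nat.cast_div_le
  have e2 : ((N / m / s1 : ℕ) : ℝ) ≤ N / m / s1 := by
    refine Nat.cast_div_le.trans ?_
    gcongr
    exact Nat.cast_div_le
  calc (S.card : ℝ) ≤ ((2 * (D / g) * (N / m / s1 + 1) : ℕ) : ℝ) := by exact_mod_cast hcard2
    _ = 2 * ((D / g : ℕ) : ℝ) * (((N / m / s1 : ℕ) : ℝ) + 1) := by push_cast; ring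
    _ ≤ 2 * (D / g) * (N / m / s1 + 1) := by gcongr
    _ = 2 * D * (N / m / (g * s1) + 1 / g) := by field_simp
    _ ≤ 2 * D * (N / m / m + 1) := by
        gcongr
        rw [div_le_one hg0']
        exact hg1
    _ = _ := by
        rw [sq]; field_simp

lemma caseB (a b N D y1 y2 : ℕ) (hy1 : 1 ≤ y1) (S : Finset ℕ)
    (hS : ∀ n ∈ S, 1 ≤ n ∧ n ≤ N ∧
      ((b * sigma1 n : ℕ) : ℤ) - ((a * n : ℕ) : ℤ) ≠ 0 ∧
      |((b * sigma1 n : ℕ) : ℤ) - ((a * n : ℕ) : ℤ)| ≤ D ∧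
      ∃ m m', n = m * m' ∧ Nat.Coprime m m' ∧ y1 ≤ m ∧ m ≤ y2) :
    (S.card : ℝ) ≤ 2 * D * (2 * N / y1 + y2) := by
  classical
  choose! h1 hN hne hD M M' hMM hcop hy hy' using hS
  have hsub : S ⊆ (Finset.Icc y1 y2).biUnion (fun m => S.filter (fun n => M n = m)) := by
    intro n hn
    rw [Finset.mem_biUnion]
    exact ⟨M n, Finset.mem_Icc.mpr ⟨hy n hn, hy' n hn⟩, Finset.mem_filter.mpr ⟨hn, rfl⟩⟩
  have hfib : ∀ m ∈ Finset.Icc y1 y2, ((S.filter (fun n => M n = m)).card : ℝ) ≤ 2 * D * (N * ((m:ℝ) ^ 2)⁻¹ + 1) := by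
    intro m hm
    rw [Finset.mem_Icc] at hm
    have hinj : Set.InjOn M' (S.filter (fun n => M n = m)) := by
      intro n hn n' hn' heq
      have hn := Finset.mem_filter.mp (Finset.mem_coe.mp hn)
      have hn' := Finset.mem_filter.mp (Finset.mem_coe.mp hn')
      rw [hMM n hn.1, hMM n' hn'.1, hn.2, hn'.2, heq]
    rw [← Finset.card_image_of_injOn hinj]
    apply caseB_fixed a b m N D (by omega)
    intro m' hm'
    rw [Finset.mem_image] at hm'
    obtain ⟨n, hn, rfl⟩ := hm'
    have hn := Finset.mem_filter.mp hn
    have e : n = m * M' n := by rw [← hn.2]; exact hMM n hn.1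
    have hc := hcop n hn.1
    rw [hn.2] at hc
    rw [← e]
    refine ⟨?_, hN n hn.1, hc, hne n hn.1, hD n hn.1⟩
    have := h1 n hn.1
    rcases Nat.eq_zero_or_pos (M' n) with h | h
    · rw [h] at e; omega
    · exact h
  calc (S.card : ℝ) ≤ (((Finset.Icc y1 y2).biUnion (fun m => S.filter (fun n => M n = m))).card : ℝ) := by
        exact_mod_cast Finset.card_le_card hsub
    _ ≤ ∑ m ∈ Finset.Icc y1 y2, ((S.filter (fun n => M n = m)).card : ℝ) := by
        exact_mod_cast Finset.card_biUnion_le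
    _ ≤ ∑ m ∈ Finset.Icc y1 y2, 2 * D * (N * ((m:ℝ) ^ 2)⁻¹ + 1) := Finset.sum_le_sum hfib
    _ = 2 * D * (N * ∑ m ∈ Finset.Icc y1 y2, ((m:ℝ) ^ 2)⁻¹ + (Finset.Icc y1 y2).card) := by
        rw [← Finset.mul_sum, Finset.sum_add_distrib, ← Finset.mul_sum]; simp
    _ ≤ 2 * D * (N * (2 / y1) + y2) := by
        have hIcc : Finset.Icc y1 y2 = Finset.Ioo (y1 - 1) (y2 + 1) := by
          ext i; simp only [Finset.mem_Icc, Finset.mem_Ioo]; omega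
        gcongr
        · rw [hIcc]
          refine (sum_Ioo_inv_sq_le (α := ℝ) _ _).trans ?_
          have : ((y1 - 1 : ℕ) : ℝ) + 1 = y1 := by
            have : y1 - 1 + 1 = y1 := by omega
            exact_mod_cast this
          rw [this]
        · rw [Nat.card_Icc]; omega
    _ = _ := by ring

lemma greedy (n : ℕ) (hn : 1 ≤ n) (Y : ℝ) (hY : 1 ≤ Y) (hYn : Y ≤ n) :
    (∃ m m', n = m * m' ∧ Nat.Coprime m m' ∧ Y ≤ m ∧ (m : ℝ) ≤ Y ^ 2) ∨
    (∃ p e m', p.Prime ∧ 1 ≤ e ∧ n = p ^ e * m' ∧ Nat.Coprime (p ^ e) m' ∧ Y ^ 2 < ((p ^ e : ℕ) : ℝ)) := by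
  classical
  have hex : ∃ m : ℕ, (∃ m', n = m * m' ∧ Nat.Coprime m m') ∧ Y ≤ (m : ℝ) := ⟨n, ⟨1, by simp, by simp⟩, hYn⟩
  obtain ⟨⟨m', hmm, hcop⟩, hYm⟩ := Nat.find_spec hex
  have hmin : ∀ k < Nat.find hex, ¬ ((∃ m', n = k * m' ∧ Nat.Coprime k m') ∧ Y ≤ (k : ℝ)) :=
    fun k hk => Nat.find_min hex hk
  set m := Nat.find hex with hm
  by_cases hle : (m : ℝ) ≤ Y ^ 2
  · exact Or.inl ⟨m, m', hmm, hcop, hYm, hle⟩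
  · right
    push Not at hle
    have hm1 : m ≠ 1 := by
      intro h; rw [h] at hle; push_cast at hle; nlinarith
    have hm0 : m ≠ 0 := by
      intro h; rw [h] at hYm; push_cast at hYm; linarith
    have hp := Nat.minFac_prime hm1
    set p := m.minFac with hpdef
    set e := m.factorization p with he
    have he1 : 1 ≤ e := hp.factorization_pos_of_dvd hm0 (Nat.minFac_dvd m)
    have hfac : p ^ e * (m / p ^ e) = m := Nat.ordProj_mul_ordCompl_eq_self m p
    have hc : Nat.Coprime (p ^ e) (m / p ^ e) := Nat.Coprime.pow_left _ (Nat.coprime_ordCompl hp hm0)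
    set t := m / p ^ e with ht
    have hq2 : 2 ≤ p ^ e := hp.two_le.trans (Nat.le_self_pow (by omega) p)
    by_cases ht1 : t = 1
    · rw [ht1, mul_one] at hfac
      refine ⟨p, e, m', hp, he1, ?_, ?_, ?_⟩
      · rw [hfac]; exact hmm
      · rw [hfac]; exact hcop
      · rw [hfac]; exact hle
    · exfalso
      have ht0 : t ≠ 0 := by intro h; rw [h] at hfac; omega
      have ht2 : 2 ≤ t := Nat.lt_of_le_of_ne (Nat.one_le_iff_ne_zero.mpr ht0) (Ne.symm ht1)
      have hqm : p ^ e < m := by nlinarith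
      have htm : t < m := by nlinarith
      have hc' : Nat.Coprime (p ^ e * t) m' := by rw [hfac]; exact hcop
      have a1 := hmin _ hqm
      have a2 := hmin _ htm
      have b1 : (((p ^ e : ℕ)) : ℝ) < Y := by
        by_contra h
        push Not at h
        refine a1 ⟨⟨t * m', ?_, ?_⟩, h⟩
        · rw [← mul_assoc, hfac]; exact hmm
        · exact Nat.Coprime.mul_right hc (Nat.Coprime.coprime_mul_right hc')
      have b2 : (t : ℝ) < Y := by
        by_contra h
        push Not at h
        refine a2 ⟨⟨p ^ e * m', ?_, ?_⟩, h⟩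
        · rw [← mul_assoc, mul_comm t, hfac]; exact hmm
        · exact Nat.Coprime.mul_right hc.symm (Nat.Coprime.coprime_mul_left hc')
      have : (m : ℝ) = ((p ^ e : ℕ) : ℝ) * t := by exact_mod_cast hfac.symm
      have b3 : (0:ℝ) ≤ t := Nat.cast_nonneg t
      have b4 : (0:ℝ) ≤ ((p ^ e : ℕ) : ℝ) := Nat.cast_nonneg _
      rw [this] at hle
      nlinarith

lemma caseSq (N R : ℕ) (hR : 1 ≤ R) (S : Finset ℕ)
    (hS : ∀ n ∈ S, 1 ≤ n ∧ n ≤ N ∧ ∃ r, r ^ 2 ∣ n ∧ R ≤ r) :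
    (S.card : ℝ) ≤ 2 * N / R := by
  classical
  choose! h1 hN r hr hRr using hS
  have hsub : S ⊆ (Finset.Icc R N).biUnion (fun i => S.filter (fun n => r n = i)) := by
    intro n hn
    rw [Finset.mem_biUnion]
    refine ⟨r n, Finset.mem_Icc.mpr ⟨hRr n hn, ?_⟩, Finset.mem_filter.mpr ⟨hn, rfl⟩⟩
    have h2 := Nat.le_of_dvd (h1 n hn) (hr n hn)
    have h3 : r n ≤ r n ^ 2 := Nat.le_self_pow (by norm_num) _
    have := hN n hn
    omega
  have hfib : ∀ i ∈ Finset.Icc R N, ((S.filter (fun n => r n = i)).card : ℝ) ≤ N * ((i:ℝ) ^ 2)⁻¹ := by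
    intro i hi
    rw [Finset.mem_Icc] at hi
    have hsub2 : S.filter (fun n => r n = i) ⊆ (Finset.Ioc 0 N).filter (fun n => i ^ 2 ∣ n) := by
      intro n hn
      have hn := Finset.mem_filter.mp hn
      rw [Finset.mem_filter, Finset.mem_Ioc, ← hn.2]
      exact ⟨⟨h1 n hn.1, hN n hn.1⟩, hr n hn.1⟩
    have h2 := Finset.card_le_card hsub2
    rw [Nat.Ioc_filter_dvd_card_eq_div] at h2
    calc ((S.filter (fun n => r n = i)).card : ℝ) ≤ ((N / i ^ 2 : ℕ) : ℝ) := by exact_mod_cast h2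
      _ ≤ N / ((i ^ 2 : ℕ) : ℝ) := Nat.cast_div_le
      _ = _ := by push_cast; rw [div_eq_mul_inv]
  calc (S.card : ℝ) ≤ (((Finset.Icc R N).biUnion (fun i => S.filter (fun n => r n = i))).card : ℝ) := by
        exact_mod_cast Finset.card_le_card hsub
    _ ≤ ∑ i ∈ Finset.Icc R N, ((S.filter (fun n => r n = i)).card : ℝ) := by
        exact_mod_cast Finset.card_biUnion_le
    _ ≤ ∑ i ∈ Finset.Icc R N, N * ((i:ℝ) ^ 2)⁻¹ := Finset.sum_le_sum hfib
    _ = N * ∑ i ∈ Finset.Icc R N, ((i:ℝ) ^ 2)⁻¹ := by rw [← Finset.mul_sum]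
    _ ≤ N * (2 / R) := by
        have hIcc : Finset.Icc R N = Finset.Ioo (R - 1) (N + 1) := by
          ext i; simp only [Finset.mem_Icc, Finset.mem_Ioo]; omega
        gcongr
        rw [hIcc]
        refine (sum_Ioo_inv_sq_le (α := ℝ) _ _).trans ?_
        have : ((R - 1 : ℕ) : ℝ) + 1 = R := by
          have : R - 1 + 1 = R := by omega
          exact_mod_cast this
        rw [this]
    _ = _ := by ring

lemma primepow_sq {p e : ℕ} (hp : p.Prime) (he : 2 ≤ e) {Y : ℝ} (h : Y ^ 6 < ((p ^ e : ℕ) : ℝ)) :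
    (p ^ (e / 2)) ^ 2 ∣ p ^ e ∧ Y ^ 2 ≤ ((p ^ (e / 2) : ℕ) : ℝ) := by
  constructor
  · rw [← pow_mul]
    exact pow_dvd_pow p (by omega)
  · have h1 : p ^ e ≤ (p ^ (e / 2)) ^ 3 := by
      rw [← pow_mul]
      exact Nat.pow_le_pow_right hp.pos (by omega)
    have h2 : ((p ^ e : ℕ) : ℝ) ≤ ((p ^ (e / 2) : ℕ) : ℝ) ^ 3 := by exact_mod_cast h1
    have h3 : (Y ^ 2) ^ 3 ≤ ((p ^ (e / 2) : ℕ) : ℝ) ^ 3 := by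
      rw [← pow_mul]; linarith
    exact le_of_pow_le_pow_left₀ (by norm_num) (Nat.cast_nonneg _) h3

lemma prime_case (a b p m D : ℕ) (hp : p.Prime) (hcop : Nat.Coprime p m)
    (hd : |((b * sigma1 (p * m) : ℕ) : ℤ) - ((a * (p * m) : ℕ) : ℤ)| ≤ D)
    (hbig : D + b * sigma1 m < p) : b * sigma1 m = a * m := by
  by_contra hne
  rw [sigma1_mul hcop, sigma1_prime hp] at hd
  have h1 : ((b * ((p + 1) * sigma1 m) : ℕ) : ℤ) - ((a * (p * m) : ℕ) : ℤ) =
      p * (((b * sigma1 m : ℕ) : ℤ) - ((a * m : ℕ) : ℤ)) + ((b * sigma1 m : ℕ) : ℤ) := by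
    push_cast; ring
  rw [h1] at hd
  have h2 : ((b * sigma1 m : ℕ) : ℤ) - ((a * m : ℕ) : ℤ) ≠ 0 := by
    intro h; apply hne; exact_mod_cast sub_eq_zero.mp h
  have h3 := Int.one_le_abs h2
  have h4 : ((D + b * sigma1 m : ℕ) : ℤ) < p := by exact_mod_cast hbig
  rw [Nat.cast_add] at h4
  set u := ((b * sigma1 m : ℕ) : ℤ) - ((a * m : ℕ) : ℤ)
  set v := ((b * sigma1 m : ℕ) : ℤ)
  have hv : 0 ≤ v := Nat.cast_nonneg _
  have h5 : (p:ℤ) * |u| = |(p * u + v) - v| := by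
    rw [add_sub_cancel_right, abs_mul, Nat.abs_cast]
  have h6 := abs_sub (p * u + v) v
  rw [abs_of_nonneg hv] at h6
  have h7 : (p:ℤ) * 1 ≤ p * |u| := by gcongr
  linarith

open Classical in
lemma main_count (a b : ℕ) (x Y : ℝ) (hY : 0 < Y) (S : Finset ℕ)
    (hS : ∀ n ∈ S, 1 ≤ n ∧ (n : ℝ) ≤ x ∧ ∃ p m : ℕ, p.Prime ∧ n = p * m ∧ (m : ℝ) < Y ∧ b * sigma1 m = a * m) :
    (S.card : ℝ) ≤ ∑ m ∈ (Finset.range ⌈Y⌉₊).filter (fun m => 0 < m ∧ b * sigma1 m = a * m),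
      (Nat.primeCounting ⌊x / m⌋₊ : ℝ) := by
  choose! h1 hx p m hp hn hm hperf using hS
  have hmpos : ∀ n ∈ S, 0 < m n := by
    intro n hnS
    rcases Nat.eq_zero_or_pos (m n) with h | h
    · have e := hn n hnS
      have := h1 n hnS
      rw [h] at e; omega
    · exact h
  set T := (Finset.range ⌈Y⌉₊).filter (fun m => 0 < m ∧ b * sigma1 m = a * m) with hT
  have hsub : S ⊆ T.biUnion (fun i => S.filter (fun n => m n = i)) := by
    intro n hnS
    rw [Finset.mem_biUnion]
    refine ⟨m n, ?_, Finset.mem_filter.mpr ⟨hnS, rfl⟩⟩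
    rw [hT, Finset.mem_filter, Finset.mem_range]
    exact ⟨Nat.lt_ceil.mpr (hm n hnS), hmpos n hnS, hperf n hnS⟩
  have hfib : ∀ i ∈ T, ((S.filter (fun n => m n = i)).card : ℝ) ≤ (Nat.primeCounting ⌊x / i⌋₊ : ℝ) := by
    intro i hi
    rw [hT, Finset.mem_filter] at hi
    have hi0 : (0:ℝ) < i := by exact_mod_cast hi.2.1
    have : (S.filter (fun n => m n = i)).card ≤ Nat.primeCounting ⌊x / i⌋₊ := by
      rw [Nat.primeCounting, Nat.primeCounting', Nat.count_eq_card_filter_range]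
      apply Finset.card_le_card_of_injOn p
      · intro n hnS
        have hnS := Finset.mem_filter.mp hnS
        simp only [Finset.coe_filter, Finset.mem_range, Set.mem_ofPred_eq]
        refine ⟨?_, hp n hnS.1⟩
        rw [Nat.lt_succ_iff]
        apply Nat.le_floor
        rw [le_div_iff₀ hi0]
        have e := hn n hnS.1
        rw [hnS.2] at e
        have e' : (n : ℝ) = p n * i := by exact_mod_cast e
        rw [← e']
        exact hx n hnS.1
      · intro n hnS n' hnS' heq
        have hnS := Finset.mem_filter.mp (Finset.mem_coe.mp hnS)
        have hnS' := Finset.mem_filter.mp (Finset.mem_coe.mp hnS')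
        rw [hn n hnS.1, hn n' hnS'.1, hnS.2, hnS'.2, heq]
    exact_mod_cast this
  calc (S.card : ℝ) ≤ ((T.biUnion (fun i => S.filter (fun n => m n = i))).card : ℝ) := by
        exact_mod_cast Finset.card_le_card hsub
    _ ≤ ∑ i ∈ T, ((S.filter (fun n => m n = i)).card : ℝ) := by
        exact_mod_cast Finset.card_biUnion_le
    _ ≤ _ := Finset.sum_le_sum hfib

open Classical in
lemma fixed_bound (a b D : ℕ) (z : ℝ) (hz : 1 ≤ z)
    (hbig : ∀ m : ℕ, 1 ≤ m → (m : ℝ) < z ^ 3 → (D : ℝ) + b * sigma1 m ≤ z ^ 6)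
    (W : Finset ℕ) (hW : ∀ n ∈ W, 1 ≤ n ∧ (n : ℝ) ≤ z ^ 9 ∧
      |((b * sigma1 n : ℕ) : ℤ) - ((a * n : ℕ) : ℤ)| ≤ D) :
    (W.card : ℝ) ≤ z ^ 3 + (W.filter (fun n => b * sigma1 n = a * n)).card + 6 * D * z ^ 6 + 2 * z ^ 7 +
      ∑ m ∈ (Finset.range ⌈z ^ 3⌉₊).filter (fun m => 0 < m ∧ b * sigma1 m = a * m),
      (Nat.primeCounting ⌊z ^ 9 / m⌋₊ : ℝ) := by
  have hz0 : 0 < z := by linarith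
  have hz3 : 1 ≤ z ^ 3 := one_le_pow₀ hz
  set N := ⌊z ^ 9⌋₊ with hN
  have hNle : (N : ℝ) ≤ z ^ 9 := Nat.floor_le (by positivity)
  set W0 := W.filter (fun n : ℕ => (n : ℝ) < z ^ 3) with hW0
  set W1 := W.filter (fun n => b * sigma1 n = a * n) with hW1
  set W2 := W.filter (fun n => b * sigma1 n ≠ a * n ∧
    ∃ m m', n = m * m' ∧ Nat.Coprime m m' ∧ z ^ 3 ≤ m ∧ (m : ℝ) ≤ z ^ 6) with hW2
  set W3 := W.filter (fun n => ∃ r : ℕ, r ^ 2 ∣ n ∧ z ^ 2 ≤ r) with hW3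
  set W4 := W.filter (fun n => ∃ p m : ℕ, p.Prime ∧ n = p * m ∧ (m : ℝ) < z ^ 3 ∧ b * sigma1 m = a * m) with hW4
  have hsub : W ⊆ W0 ∪ W1 ∪ W2 ∪ W3 ∪ W4 := by
    intro n hn
    obtain ⟨h1, hnx, hnd⟩ := hW n hn
    simp only [Finset.mem_union]
    by_cases c0 : (n : ℝ) < z ^ 3
    · exact Or.inl (Or.inl (Or.inl (Or.inl (Finset.mem_filter.mpr ⟨hn, c0⟩))))
    by_cases c1 : b * sigma1 n = a * n
    · exact Or.inl (Or.inl (Or.inl (Or.inr (Finset.mem_filter.mpr ⟨hn, c1⟩))))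
    push Not at c0
    have hz6 : (z ^ 3) ^ 2 = z ^ 6 := by ring
    rcases greedy n h1 (z ^ 3) hz3 c0 with h | ⟨p, e, m', hp, he, hfac, hcop, hlarge⟩
    · rw [hz6] at h
      exact Or.inl (Or.inl (Or.inr (Finset.mem_filter.mpr ⟨hn, c1, h⟩)))
    · rw [hz6] at hlarge
      rcases Nat.lt_or_ge e 2 with h2 | h2
      · right
        have he1 : e = 1 := by omega
        rw [he1, pow_one] at hfac hcop hlarge
        have hm1 : 1 ≤ m' := by
          rcases Nat.eq_zero_or_pos m' with h | h
          · rw [h] at hfac; omega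
          · exact h
        have hmz : (m' : ℝ) < z ^ 3 := by
          have e1 : (n : ℝ) = p * m' := by exact_mod_cast hfac
          rw [e1] at hnx
          have hm0 : (0:ℝ) < m' := by exact_mod_cast hm1
          by_contra hcon
          push Not at hcon
          have : z ^ 6 * z ^ 3 < (p : ℝ) * m' := by
            calc z ^ 6 * z ^ 3 ≤ z ^ 6 * (m' : ℝ) := by gcongr
              _ < (p : ℝ) * m' := by gcongr
          have e3 : z ^ 6 * z ^ 3 = z ^ 9 := by ring
          linarith
        refine Finset.mem_filter.mpr ⟨hn, p, m', hp, hfac, hmz, ?_⟩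
        rw [hfac] at hnd
        apply prime_case a b p m' D hp hcop hnd
        have := lt_of_le_of_lt (hbig m' hm1 hmz) hlarge
        exact_mod_cast this
      · left; right
        obtain ⟨q1, q2⟩ := primepow_sq hp h2 hlarge
        exact Finset.mem_filter.mpr ⟨hn, p ^ (e / 2), q1.trans (Dvd.intro _ hfac.symm), q2⟩
  have hcard : (W.card : ℝ) ≤ W0.card + W1.card + W2.card + W3.card + W4.card := by
    have h1 := Finset.card_le_card hsub
    have h2 := Finset.card_union_le (W0 ∪ W1 ∪ W2 ∪ W3) W4
    have h3 := Finset.card_union_le (W0 ∪ W1 ∪ W2) W3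
    have h4 := Finset.card_union_le (W0 ∪ W1) W2
    have h5 := Finset.card_union_le W0 W1
    exact_mod_cast (by omega : W.card ≤ W0.card + W1.card + W2.card + W3.card + W4.card)
  have c0 : (W0.card : ℝ) ≤ z ^ 3 := by
    have : W0 ⊆ Finset.Icc 1 ⌊z ^ 3⌋₊ := by
      intro n hn
      have hn := Finset.mem_filter.mp hn
      exact Finset.mem_Icc.mpr ⟨(hW n hn.1).1, Nat.le_floor hn.2.le⟩
    have h := Finset.card_le_card this
    rw [Nat.card_Icc, Nat.add_sub_cancel] at h
    calc (W0.card : ℝ) ≤ (⌊z ^ 3⌋₊ : ℝ) := by exact_mod_cast h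
      _ ≤ _ := Nat.floor_le (by positivity)
  have c2 : (W2.card : ℝ) ≤ 6 * D * z ^ 6 := by
    have h := caseB a b N D ⌈z ^ 3⌉₊ ⌊z ^ 6⌋₊ (Nat.one_le_ceil_iff.mpr (by positivity)) W2 (by
      intro n hn
      obtain ⟨hn, hne, m, m', h1, h2, h3, h4⟩ := Finset.mem_filter.mp hn
      obtain ⟨g1, gx, gd⟩ := hW n hn
      refine ⟨g1, Nat.le_floor gx, ?_, gd, m, m', h1, h2, Nat.ceil_le.mpr h3, Nat.le_floor h4⟩
      intro h; apply hne; exact_mod_cast sub_eq_zero.mp h)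
    refine h.trans ?_
    have e1 : 2 * (N:ℝ) / ⌈z ^ 3⌉₊ ≤ 2 * z ^ 9 / z ^ 3 := by
      gcongr
      exact Nat.le_ceil _
    have e2 : 2 * z ^ 9 / z ^ 3 = 2 * z ^ 6 := by field_simp
    have e3 : (⌊z ^ 6⌋₊ : ℝ) ≤ z ^ 6 := Nat.floor_le (by positivity)
    calc 2 * (D:ℝ) * (2 * N / ⌈z ^ 3⌉₊ + ⌊z ^ 6⌋₊) ≤ 2 * D * (3 * z ^ 6) := by
          gcongr; linarith
      _ = _ := by ring
  have c3 : (W3.card : ℝ) ≤ 2 * z ^ 7 := by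
    have h := caseSq N ⌈z ^ 2⌉₊ (Nat.one_le_ceil_iff.mpr (by positivity)) W3 (by
      intro n hn
      obtain ⟨hn, r, h1, h2⟩ := Finset.mem_filter.mp hn
      obtain ⟨g1, gx, gd⟩ := hW n hn
      exact ⟨g1, Nat.le_floor gx, r, h1, Nat.ceil_le.mpr h2⟩)
    refine h.trans ?_
    calc 2 * (N:ℝ) / ⌈z ^ 2⌉₊ ≤ 2 * z ^ 9 / z ^ 2 := by
          gcongr
          exact Nat.le_ceil _
      _ = _ := by field_simp
  have c4 := main_count a b (z ^ 9) (z ^ 3) (by positivity) W4 (by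
      intro n hn
      obtain ⟨hn, h⟩ := Finset.mem_filter.mp hn
      obtain ⟨g1, gx, gd⟩ := hW n hn
      exact ⟨g1, gx, h⟩)
  linarith

open Filter Topology in
lemma rpow_div_tendsto {s : ℝ} (hs : s < 1) :
    Tendsto (fun x : ℝ => x ^ s / (x / Real.log x)) atTop (𝓝 0) := by
  have h := (isLittleO_log_rpow_atTop (r := 1 - s) (by linarith)).tendsto_div_nhds_zero
  refine h.congr' ?_
  filter_upwards [eventually_gt_atTop 0] with x hx
  rw [Real.rpow_sub hx, Real.rpow_one]
  have := Real.rpow_pos_of_pos hx s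
  field_simp

open Filter Topology in
lemma inv_log_tendsto :
    Tendsto (fun x : ℝ => (12 * x / (Real.log x) ^ 2) / (x / Real.log x)) atTop (𝓝 0) := by
  have h : Tendsto (fun x : ℝ => 12 * (Real.log x)⁻¹) atTop (𝓝 (12 * 0)) :=
    (tendsto_inv_atTop_zero.comp Real.tendsto_log_atTop).const_mul 12
  rw [mul_zero] at h
  refine h.congr' ?_
  filter_upwards [eventually_gt_atTop 1] with x hx
  have := Real.log_pos hx
  have hx0 : 0 < x := by linarith
  field_simp

open Filter Topology Classical in
/-- the weighted sum arising from the regular solutions -/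
lemma weighted_tendsto (a b : ℕ) (ha : 0 < a) (hb : 0 < b) :
    Tendsto (fun x : ℝ => ∑ m ∈ (Finset.range ⌈(x ^ (1/9:ℝ)) ^ 3⌉₊).filter (fun m => 0 < m ∧ b * sigma1 m = a * m),
      (1 / (m:ℝ)) * (Real.log x / Real.log (x / m))) atTop
      (𝓝 (∑' m : {m : ℕ // 0 < m ∧ b * sigma1 m = a * m}, 1 / ((m : ℕ) : ℝ))) := by
  set P : Set ℕ := {m : ℕ | 0 < m ∧ b * sigma1 m = a * m} with hP
  set f : ℕ → ℝ := P.indicator (fun m => 1 / (m:ℝ)) with hf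
  have hT : ∑' m : {m : ℕ // 0 < m ∧ b * sigma1 m = a * m}, 1 / ((m : ℕ) : ℝ) = ∑' m, f m :=
    tsum_subtype P (fun m => 1 / (m:ℝ))
  have hsum : Summable f := by
    have := perfect_summable a b ha hb
    exact summable_subtype_iff_indicator.mp this
  set G : ℝ → ℕ → ℝ := fun x m => if (m:ℝ) < (x ^ (1/9:ℝ)) ^ 3 then f m * (Real.log x / Real.log (x / m)) else 0 with hG
  have hz : Tendsto (fun x : ℝ => (x ^ (1/9:ℝ)) ^ 3) atTop atTop :=
    (tendsto_pow_atTop (by norm_num)).comp (tendsto_rpow_atTop (by norm_num))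
  rw [hT]
  have key : Tendsto (fun x => ∑' m, G x m) atTop (𝓝 (∑' m, f m)) := by
    apply tendsto_tsum_of_dominated_convergence (bound := fun m => (3/2) * f m) (hsum.mul_left _)
    · intro m
      have h1 : Tendsto (fun x : ℝ => f m * (Real.log x / Real.log (x / m))) atTop (𝓝 (f m * 1)) := by
        by_cases hm : m = 0
        · have : f m = 0 := by simp [hf, hP, hm]
          simp [this]
        · apply Tendsto.const_mul
          have hm0 : (0:ℝ) < m := by positivity
          have h2 : Tendsto (fun x : ℝ => (1 - Real.log m * (Real.log x)⁻¹)⁻¹) atTop (𝓝 ((1 - Real.log m * 0)⁻¹)) := by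
            apply Tendsto.inv₀
            · exact ((tendsto_inv_atTop_zero.comp Real.tendsto_log_atTop).const_mul _).const_sub 1
            · simp
          simp only [mul_zero, sub_zero, inv_one] at h2
          refine h2.congr' ?_
          filter_upwards [eventually_gt_atTop 1] with x hx
          have hl := Real.log_pos hx
          rw [Real.log_div (by linarith) hm0.ne']
          have e : 1 - Real.log m * (Real.log x)⁻¹ = (Real.log x - Real.log m) / Real.log x := by field_simp
          rw [e, inv_div]
      rw [mul_one] at h1
      refine h1.congr' ?_
      filter_upwards [hz.eventually_gt_atTop (m:ℝ)] with x hx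
      simp only [hG]
      rw [if_pos hx]
    · filter_upwards [eventually_gt_atTop 1] with x hx m
      have hf0 : 0 ≤ f m := Set.indicator_nonneg (fun _ _ => by positivity) _
      have hx0 : 0 < x := by linarith
      simp only [hG]
      split_ifs with h
      · by_cases hm : m = 0
        · have : f m = 0 := by simp [hf, hP, hm]
          simp [this]
        · have hm0 : (0:ℝ) < m := by positivity
          have hl := Real.log_pos hx
          have hlm : Real.log m ≤ (1/3) * Real.log x := by
            have := Real.log_le_log hm0 h.le
            rw [Real.log_pow, Real.log_rpow hx0] at this
            push_cast at this
            linarith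
          rw [Real.log_div hx0.ne' hm0.ne', norm_mul, Real.norm_of_nonneg hf0,
            Real.norm_of_nonneg (div_nonneg hl.le (by linarith)), mul_comm]
          refine mul_le_mul_of_nonneg_right ?_ hf0
          rw [div_le_iff₀ (by linarith)]
          linarith
      · simp; positivity
  refine key.congr ?_
  intro x
  rw [tsum_eq_sum (s := (Finset.range ⌈(x ^ (1/9:ℝ)) ^ 3⌉₊).filter (fun m => 0 < m ∧ b * sigma1 m = a * m))]
  · apply Finset.sum_congr rfl
    intro m hm
    rw [Finset.mem_filter, Finset.mem_range, Nat.lt_ceil] at hm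
    simp only [hG]
    rw [if_pos hm.1, hf, Set.indicator_of_mem (show m ∈ P from hm.2)]
  · intro m hm
    rw [Finset.mem_filter, Finset.mem_range, Nat.lt_ceil] at hm
    simp only [hG]
    by_cases h : (m:ℝ) < (x ^ (1/9:ℝ)) ^ 3
    · rw [if_pos h, hf, Set.indicator_of_notMem, zero_mul]
      intro h2
      exact hm ⟨h, h2⟩
    · rw [if_neg h]

open Filter in
lemma perfect_count_real (a b : ℕ) (ha : 0 < a) (hb : 0 < b) : ∀ᶠ x : ℝ in atTop, ∀ S : Finset ℕ,
    (∀ n ∈ S, 1 ≤ n ∧ (n : ℝ) ≤ x ∧ b * sigma1 n = a * n) →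
    (S.card : ℝ) ≤ 12 * x / (Real.log x) ^ 2 := by
  filter_upwards [tendsto_nat_floor_atTop.eventually (perfect_count' a b ha hb), eventually_ge_atTop (4:ℝ)] with x h hx S hS
  have h1 := h S (fun n hn => ⟨(hS n hn).1, Nat.le_floor (hS n hn).2.1, (hS n hn).2.2⟩)
  refine h1.trans ?_
  have hx0 : 0 < x := by linarith
  have hN : (⌊x⌋₊ : ℝ) ≤ x := Nat.floor_le hx0.le
  have hN2 : Real.sqrt x ≤ ⌊x⌋₊ := by
    have e1 := Nat.lt_floor_add_one x
    have e2 : Real.sqrt x ≤ x / 2 := by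
      rw [Real.sqrt_le_left (by linarith)]; nlinarith
    linarith
  have hs : 0 < Real.sqrt x := Real.sqrt_pos.mpr hx0
  have hl : 0 < Real.log x := Real.log_pos (by linarith)
  have hlog : Real.log x / 2 ≤ Real.log ⌊x⌋₊ := by
    rw [← Real.log_sqrt hx0.le]
    exact Real.log_le_log hs hN2
  calc 3 * (⌊x⌋₊ : ℝ) / (Real.log ⌊x⌋₊) ^ 2 ≤ 3 * x / (Real.log x / 2) ^ 2 := by gcongr
    _ = _ := by field_simp; norm_num

open Filter Topology Classical in
lemma main_eventually (c : ℝ) (hc' : c < 1 / 3)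
    (k : ℝ → ℝ) (hkub : ∀ y : ℝ, 1 ≤ y → k y ≤ y ^ c) (hc : 0 < c)
    (a b : ℕ) (ha : 0 < a) (hb : 0 < b) (ℓ : ℝ) (hℓab : ℓ = (a : ℝ) / b) (ε : ℝ) (hε : 0 < ε) :
    ∀ᶠ x : ℝ in atTop, (withinPerfectCount ℓ k x : ℝ) / (x / Real.log x) ≤
      x ^ (1/3:ℝ) / (x / Real.log x) + (12 * x / (Real.log x) ^ 2) / (x / Real.log x) +
      6 * b * (x ^ (c + 2/3) / (x / Real.log x)) + 2 * (x ^ (7/9:ℝ) / (x / Real.log x)) +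
      (1 + ε) * ∑ m ∈ (Finset.range ⌈(x ^ (1/9:ℝ)) ^ 3⌉₊).filter (fun m => 0 < m ∧ b * sigma1 m = a * m),
      (1 / (m:ℝ)) * (Real.log x / Real.log (x / m)) := by
  obtain ⟨X0, hX0⟩ := eventually_atTop.mp (pi_upper hε)
  have hzt : Tendsto (fun x : ℝ => x ^ (1/9:ℝ)) atTop atTop := tendsto_rpow_atTop (by norm_num)
  filter_upwards [perfect_count_real a b ha hb, eventually_gt_atTop (1:ℝ), hzt.eventually_ge_atTop (5 * b),
    hzt.eventually_ge_atTop X0, hzt.eventually_ge_atTop 1] with x hperf hx hz5 hzX hz1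
  have hx0 : 0 < x := by linarith
  have hb0 : (0:ℝ) < b := by exact_mod_cast hb
  set z := x ^ (1/9:ℝ) with hz
  have hz0 : 0 < z := by linarith
  have hpow : ∀ j : ℕ, z ^ j = x ^ ((j:ℝ) / 9) := by
    intro j
    rw [hz, ← Real.rpow_natCast, ← Real.rpow_mul hx0.le]
    congr 1; ring
  have hz9 : z ^ 9 = x := by rw [hpow]; norm_num
  have hz3 : z ^ 3 = x ^ (1/3:ℝ) := by rw [hpow]; norm_num
  have hz6 : z ^ 6 = x ^ (2/3:ℝ) := by rw [hpow]; norm_num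
  have hz7 : z ^ 7 = x ^ (7/9:ℝ) := by rw [hpow]; norm_num
  have hl : 0 < Real.log x := Real.log_pos hx
  set Q := x / Real.log x with hQ
  have hQ0 : 0 < Q := by positivity
  -- the set of within-perfect numbers as a finset
  set Wset : Set ℕ := {n : ℕ | 1 ≤ n ∧ (n : ℝ) ≤ x ∧ |(sigma1 n : ℝ) - ℓ * n| < k n} with hWset
  have hfin : Wset.Finite := by
    apply (Finset.Icc 1 ⌊x⌋₊).finite_toSet.subset
    intro n hn
    rw [Finset.mem_coe, Finset.mem_Icc]
    exact ⟨hn.1, Nat.le_floor hn.2.1⟩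
  set W := hfin.toFinset with hW
  have hcount : withinPerfectCount ℓ k x = W.card := by
    unfold withinPerfectCount
    exact Set.ncard_eq_toFinset_card Wset hfin
  set D := ⌊b * x ^ c⌋₊ with hD
  have hDle : (D:ℝ) ≤ b * x ^ c := Nat.floor_le (by positivity)
  have hWprop : ∀ n ∈ W, 1 ≤ n ∧ (n : ℝ) ≤ z ^ 9 ∧
      |((b * sigma1 n : ℕ) : ℤ) - ((a * n : ℕ) : ℤ)| ≤ D := by
    intro n hn
    rw [hW, Set.Finite.mem_toFinset] at hn
    obtain ⟨h1, h2, h3⟩ := hn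
    refine ⟨h1, by rw [hz9]; exact h2, ?_⟩
    have h4 : |(b:ℝ) * sigma1 n - a * n| ≤ b * x ^ c := by
      have e : (b:ℝ) * sigma1 n - a * n = b * ((sigma1 n : ℝ) - ℓ * n) := by
        rw [hℓab]; field_simp
      rw [e, abs_mul, abs_of_pos hb0]
      have hn1 : (1:ℝ) ≤ n := by exact_mod_cast h1
      have h5 := hkub n hn1
      have h6 : (n:ℝ) ^ c ≤ x ^ c := Real.rpow_le_rpow (by linarith) h2 hc.le
      gcongr
      linarith
    have h7 : ((|((b * sigma1 n : ℕ) : ℤ) - ((a * n : ℕ) : ℤ)|).natAbs : ℝ) ≤ b * x ^ c := by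
      rw [Nat.cast_natAbs, abs_abs]
      push_cast
      exact h4
    have h8 := Nat.le_floor h7
    rw [← hD] at h8
    omega
  have hbig : ∀ m : ℕ, 1 ≤ m → (m : ℝ) < z ^ 3 → (D : ℝ) + b * sigma1 m ≤ z ^ 6 := by
    intro m hm hmz
    have hm1 : (1:ℝ) ≤ m := by exact_mod_cast hm
    have h1 := sigma1_le (n := m) hm
    have h2 : Real.log m ≤ 3 * z := by
      have e1 := Real.log_le_log (by linarith) hmz.le
      rw [Real.log_pow] at e1
      have e2 := Real.log_le_sub_one_of_pos hz0
      push_cast at e1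
      linarith
    have h3 : (m:ℝ) * (1 + Real.log m) ≤ z ^ 3 * (1 + 3 * z) := by
      have := Real.log_nonneg hm1
      gcongr
    have h4 : x ^ c ≤ z ^ 3 := by
      rw [hz3]
      exact Real.rpow_le_rpow_of_exponent_le hx.le hc'.le
    have h5 : z ^ 3 ≤ z ^ 4 := pow_le_pow_right₀ hz1 (by norm_num)
    calc (D : ℝ) + b * sigma1 m ≤ b * z ^ 3 + b * (z ^ 3 * (1 + 3 * z)) := by
          have : (b:ℝ) * x ^ c ≤ b * z ^ 3 := by gcongr
          have : (b:ℝ) * sigma1 m ≤ b * (z ^ 3 * (1 + 3 * z)) := by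
            gcongr
            linarith
          linarith
      _ = b * (2 * z ^ 3 + 3 * z ^ 4) := by ring
      _ ≤ b * (5 * z ^ 4) := by gcongr; linarith
      _ = (5 * b) * z ^ 4 := by ring
      _ ≤ z * z ^ 4 := by gcongr
      _ = z ^ 5 := by ring
      _ ≤ z ^ 6 := pow_le_pow_right₀ hz1 (by norm_num)
  have hmain := fixed_bound a b D z hz1 hbig W hWprop
  have hp := hperf (W.filter (fun n => b * sigma1 n = a * n)) (by
    intro n hn
    obtain ⟨hn1, hn2⟩ := Finset.mem_filter.mp hn
    obtain ⟨g1, g2, g3⟩ := hWprop n hn1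
    rw [hz9] at g2
    exact ⟨g1, g2, hn2⟩)
  have hDz : 6 * (D:ℝ) * z ^ 6 ≤ 6 * b * x ^ (c + 2/3) := by
    rw [Real.rpow_add hx0, ← hz6]
    calc 6 * (D:ℝ) * z ^ 6 ≤ 6 * (b * x ^ c) * z ^ 6 := by gcongr
      _ = _ := by ring
  have hpi : ∑ m ∈ (Finset.range ⌈z ^ 3⌉₊).filter (fun m => 0 < m ∧ b * sigma1 m = a * m),
      (Nat.primeCounting ⌊z ^ 9 / m⌋₊ : ℝ) ≤ ((1 + ε) * ∑ m ∈ (Finset.range ⌈z ^ 3⌉₊).filter (fun m => 0 < m ∧ b * sigma1 m = a * m),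
      (1 / (m:ℝ)) * (Real.log x / Real.log (x / m))) * Q := by
    rw [Finset.mul_sum, Finset.sum_mul]
    apply Finset.sum_le_sum
    intro m hm
    rw [Finset.mem_filter, Finset.mem_range, Nat.lt_ceil] at hm
    have hm0 : (0:ℝ) < m := by exact_mod_cast hm.2.1
    rw [hz9]
    have h1 : z ≤ x / m := by
      rw [le_div_iff₀ hm0]
      calc z * m ≤ z * z ^ 3 := by gcongr; exact hm.1.le
        _ = z ^ 4 := by ring
        _ ≤ z ^ 9 := pow_le_pow_right₀ hz1 (by norm_num)
        _ = x := hz9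
    refine (hX0 (x / m) (hzX.trans h1)).trans (le_of_eq ?_)
    rw [hQ]
    field_simp
  rw [hcount, div_le_iff₀ hQ0]
  have expand : (x ^ (1/3:ℝ) / Q + (12 * x / (Real.log x) ^ 2) / Q +
      6 * b * (x ^ (c + 2/3) / Q) + 2 * (x ^ (7/9:ℝ) / Q) +
      (1 + ε) * ∑ m ∈ (Finset.range ⌈z ^ 3⌉₊).filter (fun m => 0 < m ∧ b * sigma1 m = a * m),
      (1 / (m:ℝ)) * (Real.log x / Real.log (x / m))) * Q =
      x ^ (1/3:ℝ) + 12 * x / (Real.log x) ^ 2 + 6 * b * x ^ (c + 2/3) + 2 * x ^ (7/9:ℝ) +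
      ((1 + ε) * ∑ m ∈ (Finset.range ⌈z ^ 3⌉₊).filter (fun m => 0 < m ∧ b * sigma1 m = a * m),
      (1 / (m:ℝ)) * (Real.log x / Real.log (x / m))) * Q := by
    rw [add_mul, add_mul, add_mul, add_mul, div_mul_cancel₀ _ hQ0.ne', div_mul_cancel₀ _ hQ0.ne',
      mul_assoc (6 * (b:ℝ)), div_mul_cancel₀ _ hQ0.ne', mul_assoc 2, div_mul_cancel₀ _ hQ0.ne']
  rw [expand, ← hz3, ← hz7]
  linarith

open Filter Topology in
lemma limsup_bound (c : ℝ) (hc' : c < 1 / 3)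
    (k : ℝ → ℝ) (hkub : ∀ y : ℝ, 1 ≤ y → k y ≤ y ^ c) (hc : 0 < c)
    (a b : ℕ) (ha : 0 < a) (hb : 0 < b) (ℓ : ℝ) (hℓab : ℓ = (a : ℝ) / b) (ε : ℝ) (hε : 0 < ε) :
    limsup (fun x : ℝ => (withinPerfectCount ℓ k x : ℝ) / (x / Real.log x)) atTop ≤
      (1 + ε) * ∑' m : {m : ℕ // 0 < m ∧ b * sigma1 m = a * m}, 1 / ((m : ℕ) : ℝ) := by
  classical
  have hev := main_eventually c hc' k hkub hc a b ha hb ℓ hℓab ε hε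
  have hlim := ((((rpow_div_tendsto (s := 1/3) (by norm_num)).add inv_log_tendsto).add
    ((rpow_div_tendsto (s := c + 2/3) (by linarith)).const_mul (6 * (b:ℝ)))).add
    ((rpow_div_tendsto (s := 7/9) (by norm_num)).const_mul 2)).add
    ((weighted_tendsto a b ha hb).const_mul (1 + ε))
  simp only [mul_zero, add_zero, zero_add] at hlim
  rw [← hlim.limsup_eq]
  refine limsup_le_limsup ?_ ?_ ?_
  · exact hev
  · refine isCoboundedUnder_le_of_eventually_le atTop (x := 0) ?_
    filter_upwards [eventually_gt_atTop (1:ℝ)] with x hx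
    have := Real.log_pos hx
    positivity
  · exact hlim.isBoundedUnder_le
end NT

theorem stmt_13 (c : ℝ) (hc : 0 < c) (hc' : c < 1 / 3)
    (k : ℝ → ℝ) (hkpos : ∀ y : ℝ, 1 ≤ y → 0 < k y)
    (hkmono : MonotoneOn k (Set.Ici 1))
    (hkunb : ∀ M : ℝ, ∃ y : ℝ, 1 ≤ y ∧ M < k y)
    (hkub : ∀ y : ℝ, 1 ≤ y → k y ≤ y ^ c)
    (a b : ℕ) (ha : 0 < a) (hb : 0 < b) (hab : Nat.Coprime a b)
    (ℓ : ℝ) (hℓab : ℓ = (a : ℝ) / b) (hℓ : 1 < ℓ)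
    (hmemSigma : ∃ m : ℕ, 0 < m ∧ (sigma1 m : ℝ) = ℓ * m) :
    Filter.limsup (fun x : ℝ => (withinPerfectCount ℓ k x : ℝ) / (x / Real.log x))
        Filter.atTop
      ≤ ∑' m : {m : ℕ // 0 < m ∧ (sigma1 m : ℝ) = ℓ * m}, 1 / ((m : ℕ) : ℝ) := by
  have hb0 : (0:ℝ) < b := by exact_mod_cast hb
  have hiff : ∀ m : ℕ, (0 < m ∧ (sigma1 m : ℝ) = ℓ * m) ↔ (0 < m ∧ b * sigma1 m = a * m) := by
    intro m
    refine and_congr_right fun _ => ?_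
    rw [hℓab, div_mul_eq_mul_div, eq_div_iff hb0.ne', mul_comm (sigma1 m : ℝ)]
    exact_mod_cast Iff.rfl
  have hT : ∑' m : {m : ℕ // 0 < m ∧ (sigma1 m : ℝ) = ℓ * m}, 1 / ((m : ℕ) : ℝ) =
      ∑' m : {m : ℕ // 0 < m ∧ b * sigma1 m = a * m}, 1 / ((m : ℕ) : ℝ) :=
    Equiv.tsum_eq (Equiv.subtypeEquivRight hiff) (fun m : {m : ℕ // 0 < m ∧ b * sigma1 m = a * m} => 1 / ((m : ℕ) : ℝ))
  rw [hT]
  set T := ∑' m : {m : ℕ // 0 < m ∧ b * sigma1 m = a * m}, 1 / ((m : ℕ) : ℝ) with hTdef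
  have hT0 : 0 ≤ T := tsum_nonneg fun _ => by positivity
  apply le_of_forall_pos_le_add
  intro δ hδ
  have h := limsup_bound c hc' k hkub hc a b ha hb ℓ hℓab (δ / (T + 1)) (by positivity)
  refine h.trans ?_
  rw [← hTdef]
  have : δ / (T + 1) * T ≤ δ := by
    rw [div_mul_eq_mul_div, div_le_iff₀ (by positivity)]
    nlinarith
  linarith
end
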